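/- arXiv:1510.03493 — 4 statements merged into one kernel-verified Lean document; each statement's English description precedes it below -/
import Mathlib

section
/- Let n ≥ 1 and let X, Y be consistent subsets of binom([n], 3). Then X ≤ Y in the single-step inclusion order if and only if X ⊆ Y. (Equivalently: whenever X ⊆ Y are consistent subsets of binom([n],3), there is a sequence X = X_0 ⊆ X_1 ⊆ ⋯ ⊆ X_t = Y of consistent subsets of binom([n],3) with |X_i ∖ X_{i−1}| = 1 for each i.) In other words, the second higher Bruhat order B(n,2) coincides with the inclusion order B_⊆(n,2). -/
open Finset

/-- `[n] = {1, …, n}`. -/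
def box (n : ℕ) : Finset ℕ := Finset.Icc 1 n

/-- `binom([n], k)`, the set of `k`-element subsets of `[n]`. -/
def binom (n k : ℕ) : Finset (Finset ℕ) := Finset.powersetCard k (box n)

/-- `X ⊆ binom([n], d+1)` is closed if for every `(d-1)`-subset `I` of `[n]` and all
`i < j < k` in `[n] ∖ I`, membership of `I∪{i,j}` and `I∪{j,k}` in `X` forces
`I∪{i,k} ∈ X`. -/
def IsClosedSet (n d : ℕ) (X : Finset (Finset ℕ)) : Prop :=
  ∀ I ∈ binom n (d - 1), ∀ i ∈ box n, ∀ j ∈ box n, ∀ k ∈ box n,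
    i ∉ I → j ∉ I → k ∉ I → i < j → j < k →
      I ∪ {i, j} ∈ X → I ∪ {j, k} ∈ X → I ∪ {i, k} ∈ X

/-- `X` is a consistent subset of `binom([n], d+1)`:
both `X` and its complement in `binom([n], d+1)` are closed. -/
def Consistent (n d : ℕ) (X : Finset (Finset ℕ)) : Prop :=
  X ⊆ binom n (d + 1) ∧ IsClosedSet n d X ∧ IsClosedSet n d (binom n (d + 1) \ X)

open Classical in
/-- The smallest closed subset of `binom([n], d+1)` containing `S`. -/
noncomputable def closureHB (n d : ℕ) (S : Finset (Finset ℕ)) : Finset (Finset ℕ) :=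
  (binom n (d + 1)).filter fun I =>
    ∀ T ⊆ binom n (d + 1), S ⊆ T → IsClosedSet n d T → I ∈ T

open Classical in
/-- The ascent set `Asc(X, Y) = {I ∈ Y ∖ X : X ∪ {I} is consistent}`. -/
noncomputable def ascSet (n d : ℕ) (X Y : Finset (Finset ℕ)) : Finset (Finset ℕ) :=
  (Y \ X).filter fun I => Consistent n d (X ∪ {I})

/-- Single-step inclusion order on consistent subsets of `binom([n],3)`. -/
def SingleStepLE (n : ℕ) (X Y : Finset (Finset ℕ)) : Prop :=
  ∃ (t : ℕ) (c : ℕ → Finset (Finset ℕ)),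
    c 0 = X ∧ c t = Y ∧ (∀ i, i ≤ t → Consistent n 2 (c i)) ∧
    ∀ i, i < t → c i ⊆ c (i + 1) ∧ (c (i + 1) \ c i).card = 1

/-- The elements `j`, `k` appear in this order on the pseudoline `i` of the arrangement whose set of
inverted triples is `t`. -/
def Before {α : Type*} [LinearOrder α] (t : α → α → α → Prop) (i j k : α) : Prop :=
  i ≠ j ∧ i ≠ k ∧ j ≠ k ∧ (j < k ↔ ¬ t i j k)

/-- A symmetric ternary predicate is an arrangement if the order it induces on each pseudoline is
transitive. -/
structure IsArrangement {α : Type*} [LinearOrder α] (t : α → α → α → Prop) : Prop where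
  swap_left : ∀ i j k, t i j k ↔ t j i k
  swap_right : ∀ i j k, t i j k ↔ t i k j
  trans : ∀ i a b c, Before t i a b → Before t i b c → Before t i a c

theorem Before.asymm {α : Type*} [LinearOrder α] {t : α → α → α → Prop} (ht : IsArrangement t)
    {i j k : α} (h : Before t i j k) : ¬ Before t i k j := by
  have := ht.swap_right i j k
  unfold Before at *
  grind

theorem Before.total {α : Type*} [LinearOrder α] {t : α → α → α → Prop} (ht : IsArrangement t)
    {i j k : α} (hij : i ≠ j) (hik : i ≠ k) (hjk : j ≠ k) :
    Before t i j k ∨ Before t i k j := by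
  have := ht.swap_right i j k
  unfold Before at *
  grind

/-- The order on a pseudoline has no 3-cycles. -/
theorem IsArrangement.acyclic {α : Type*} [LinearOrder α] {t : α → α → α → Prop}
    (ht : IsArrangement t) {i a b c : α} (hia : i ≠ a) (hib : i ≠ b) (hic : i ≠ c)
    (hab : a ≠ b) (hbc : b ≠ c) (hac : a ≠ c) :
    ¬ ((a < b ↔ ¬ t i a b) ∧ (b < c ↔ ¬ t i b c) ∧ (c < a ↔ ¬ t i a c)) ∧
    ¬ ((b < a ↔ ¬ t i a b) ∧ (c < b ↔ ¬ t i b c) ∧ (a < c ↔ ¬ t i a c)) := by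
  constructor
  · rintro ⟨h1, h2, h3⟩
    have h := ht.trans i a b c ⟨hia, hib, hab, h1⟩ ⟨hib, hic, hbc, h2⟩
    exact h.asymm ht ⟨hic, hia, hac.symm, by rwa [ht.swap_right]⟩
  · rintro ⟨h1, h2, h3⟩
    have h := ht.trans i c b a ⟨hic, hib, hbc.symm, by rwa [ht.swap_right]⟩
      ⟨hib, hia, hab.symm, by rwa [ht.swap_right]⟩
    exact h.asymm ht ⟨hia, hic, hac, h3⟩

/-- The absence of 3-cycles on each of four pseudolines, in terms of their four triples. -/
theorem IsArrangement.acyclic₄ {α : Type*} [LinearOrder α] {t : α → α → α → Prop}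
    (ht : IsArrangement t) {a b c d : α} (hab : a ≠ b) (hac : a ≠ c) (had : a ≠ d)
    (hbc : b ≠ c) (hbd : b ≠ d) (hcd : c ≠ d) :
    (¬ ((b < c ↔ ¬ t a b c) ∧ (c < d ↔ ¬ t a c d) ∧ (d < b ↔ ¬ t a b d)) ∧
     ¬ ((c < b ↔ ¬ t a b c) ∧ (d < c ↔ ¬ t a c d) ∧ (b < d ↔ ¬ t a b d))) ∧
    (¬ ((a < c ↔ ¬ t a b c) ∧ (c < d ↔ ¬ t b c d) ∧ (d < a ↔ ¬ t a b d)) ∧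
     ¬ ((c < a ↔ ¬ t a b c) ∧ (d < c ↔ ¬ t b c d) ∧ (a < d ↔ ¬ t a b d))) ∧
    (¬ ((a < b ↔ ¬ t a b c) ∧ (b < d ↔ ¬ t b c d) ∧ (d < a ↔ ¬ t a c d)) ∧
     ¬ ((b < a ↔ ¬ t a b c) ∧ (d < b ↔ ¬ t b c d) ∧ (a < d ↔ ¬ t a c d))) ∧
    (¬ ((a < b ↔ ¬ t a b d) ∧ (b < c ↔ ¬ t b c d) ∧ (c < a ↔ ¬ t a c d)) ∧
     ¬ ((b < a ↔ ¬ t a b d) ∧ (c < b ↔ ¬ t b c d) ∧ (a < c ↔ ¬ t a c d))) := by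
  have hl := ht.swap_left
  have hr := ht.swap_right
  refine ⟨ht.acyclic hab hac had hbc hcd hbd, ?_, ?_, ?_⟩
  · have := ht.acyclic hab.symm hbc hbd hac hcd had
    rwa [hl b a c, hl b a d] at this
  · have := ht.acyclic hac.symm hbc.symm hcd hab hbd had
    rwa [hl c a b, hr a c b, hl c b d, hl c a d] at this
  · have := ht.acyclic had.symm hbd.symm hcd.symm hab hbc hac
    rwa [hl d a b, hr a d b, hl d b c, hr b d c, hl d a c, hr a d c] at this

theorem IsArrangement.mono_last {α : Type*} [LinearOrder α] {t : α → α → α → Prop}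
    (ht : IsArrangement t) {i j k m : α} (hi : i < m) (hj : j < m) (hk : k < m)
    (h : Before t i j k) (hm : t i j m) : t i k m := by
  obtain ⟨h1, h2, h3, h4⟩ := h
  have := ht.acyclic₄ h1 h2 hi.ne h3 hj.ne hk.ne
  grind

/-- A pseudoline crossing one side of a triangle crosses one of the other two sides. -/
theorem IsArrangement.pasch {α : Type*} [LinearOrder α] {t : α → α → α → Prop}
    (ht : IsArrangement t) {y x z w : α} (hyx : y < x) (hxz : x < z)
    (h : ¬ t y x z) (h1 : Before t x y w) (h2 : Before t x w z) :
    (Before t y x w ∧ Before t y w z) ∨ (Before t z y w ∧ Before t z w x) := by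
  obtain ⟨-, hxw, hyw, h1⟩ := h1
  obtain ⟨-, -, hwz, h2⟩ := h2
  have := ht.acyclic₄ hyx.ne (hyx.trans hxz).ne hyw hxz.ne hxw hwz.symm
  unfold Before at *
  simp only [ht.swap_left, ht.swap_right] at *
  grind

theorem IsArrangement.corner_symm {α : Type*} [LinearOrder α] {t : α → α → α → Prop}
    (ht : IsArrangement t) {y x z w : α} (hyx : y < x) (hxz : x < z)
    (h : ¬ t y x z) (hb : ¬ (Before t x y w ∧ Before t x w z))
    (h1 : Before t z y w) (h2 : Before t z w x) :
    Before t y x w ∧ Before t y w z := by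
  obtain ⟨-, hzw, hyw, h1⟩ := h1
  obtain ⟨-, -, hwx, h2⟩ := h2
  have := ht.acyclic₄ hyx.ne (hyx.trans hxz).ne hyw hxz.ne hwx.symm hzw
  unfold Before at *
  simp only [ht.swap_left, ht.swap_right] at *
  grind

theorem IsArrangement.corner {α : Type*} [LinearOrder α] {t s : α → α → α → Prop}
    (ht : IsArrangement t) (hs : IsArrangement s) (hts : ∀ i j k, t i j k → s i j k)
    {y x z w : α} (hyx : y < x) (hxz : x < z)
    (h : ¬ t y x z) (hsx : s y x z) (hb : ¬ (Before t x y w ∧ Before t x w z))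
    (h1 : Before t y x w) (h2 : Before t y w z) :
    y < w ∧ w < z ∧ s y w z ∧ ¬ t y w z ∧ Before t z w x ∧
      ¬ (Before t w y x ∧ Before t w x z) := by
  obtain ⟨-, hyw, hxw, h1⟩ := h1
  obtain ⟨-, -, hwz, h2⟩ := h2
  have a1 := ht.acyclic₄ hyx.ne (hyx.trans hxz).ne hyw hxz.ne hxw hwz.symm
  have a2 := hs.acyclic₄ hyx.ne (hyx.trans hxz).ne hyw hxz.ne hxw hwz.symm
  have m1 := hts y x z
  have m2 := hts y x w
  have m3 := hts y z w
  have m4 := hts x z w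
  have e1 : s y w z ↔ s y z w := hs.swap_right _ _ _
  clear hts
  unfold Before at *
  rw [e1]
  simp only [ht.swap_left, ht.swap_right] at *
  grind

theorem IsArrangement.split {α : Type*} [LinearOrder α] {t s : α → α → α → Prop}
    (ht : IsArrangement t) (hs : IsArrangement s)
    {y x w u : α} (hyx : y < x) (hxw : x < w) (hwu : w < u)
    (h : ¬ t y x u) (hsx : s y x u)
    (h1 : Before t x y w) (h2 : Before t x w u) :
    (s y x w ∧ ¬ t y x w) ∨ (s y w u ∧ ¬ t y w u) := by
  have a1 := ht.acyclic₄ hyx.ne (hyx.trans hxw).ne (hyx.trans (hxw.trans hwu)).ne hxw.ne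
    (hxw.trans hwu).ne hwu.ne
  have a2 := hs.acyclic₄ hyx.ne (hyx.trans hxw).ne (hyx.trans (hxw.trans hwu)).ne hxw.ne
    (hxw.trans hwu).ne hwu.ne
  have e1 : t x y w ↔ t y x w := ht.swap_left _ _ _
  unfold Before at *
  rw [e1] at h1
  grind

/-- The crossings of an arrangement can be ranked compatibly with the order on every pseudoline. -/
theorem IsArrangement.exists_rank {α : Type*} [LinearOrder α] {t : α → α → α → Prop}
    (ht : IsArrangement t) (V : Finset α) :
    ∃ (r : α → α → ℕ) (K : ℕ), (∀ i j, r i j < K) ∧ (∀ i j, r i j = r j i) ∧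
      ∀ i ∈ V, ∀ j ∈ V, ∀ k ∈ V, Before t i j k → r i j < r i k := by
  classical
  induction V using Finset.induction_on_max with
  | empty => exact ⟨fun _ _ => 0, 1, by simp⟩
  | insert m s hm ih =>
    obtain ⟨r, K, hK, hsymm, hr⟩ := ih
    let pos : α → ℕ := fun j => #{i ∈ s | Before t m i j}
    have hpos : ∀ j, pos j ≤ #s := fun j => card_filter_le _ _
    have hlt : ∀ i ∈ s, ∀ j, Before t m i j → pos i < pos j := by
      intro i hi j hij
      refine card_lt_card ⟨fun k hk => ?_, fun h => ?_⟩
      · simp only [mem_filter] at hk ⊢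
        exact ⟨hk.1, ht.trans _ _ _ _ hk.2 hij⟩
      · have := h (mem_filter.2 ⟨hi, hij⟩)
        exact (mem_filter.1 this).2.2.2.1 rfl
    clear_value pos
    refine ⟨fun i j => if i = m then K + pos j else if j = m then K + pos i else
      if t i j m then K + #s + 1 + r i j else r i j, 2 * K + #s + 2, ?_, ?_, ?_⟩
    · intro i j
      have := hK i j
      have := hpos i
      have := hpos j
      grind
    · intro i j
      have := ht.swap_left i j m
      have := hsymm i j
      grind
    · intro i hi j hj k hk h
      have h1 := hK i j
      have h2 := hpos i
      have h3 := hpos j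
      have h4 := hpos k
      have hd := h
      obtain ⟨hij, hik, hjk, h0⟩ := hd
      rw [mem_insert] at hi hj hk
      rcases hi with rfl | hi
      · have := hlt j (by grind) k h
        simpa using this
      have him := hm i hi
      rcases hj with rfl | hj
      · have hkm := hm k (by grind)
        have : t i k j := by
          rw [ht.swap_right]
          by_contra hc
          exact lt_asymm hkm (h0.2 hc)
        simp [hij, hjk.symm, this]
        omega
      have hjm := hm j hj
      rcases hk with rfl | hk
      · have : ¬ t i j k := h0.1 hjm
        simp [hik, hjk, this]
        omega
      have hkm := hm k hk
      have := hr i hi j hj k hk h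
      have := ht.mono_last him hjm hkm h
      simp only [him.ne, hjm.ne, hkm.ne, if_false]
      grind

/-- Among the triples inverted in `s` but not in `t`, one can be found whose outer members are
adjacent on its middle pseudoline. -/
theorem exists_adjacent {α : Type*} [LinearOrder α] [Fintype α] {t s : α → α → α → Prop}
    (ht : IsArrangement t) (hs : IsArrangement s) (hts : ∀ i j k, t i j k → s i j k)
    {r : α → α → ℕ} (hr : ∀ i j k, Before t i j k → r i j < r i k)
    (y : α) (C : Finset α)
    (hne : ∃ u ∈ C, ∃ x ∈ C, y < x ∧ x < u ∧ s y x u ∧ ¬ t y x u)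
    (hC : ∀ u ∈ C, ∀ x ∈ C, y < x → x < u → s y x u → ¬ t y x u →
      ∀ w, Before t x y w → (∀ c ∈ C, u ≤ c → Before t x y c → Before t x w c) → w ∈ C) :
    ∃ p x e, p < x ∧ x < e ∧ s p x e ∧ ¬ t p x e ∧
      (∀ w, ¬ (Before t x p w ∧ Before t x w e)) ∧ x ∈ C ∧ (p = y ∨ Before t x y p) ∧
      ∃ u ∈ C, x < u ∧ ∀ c, u ≤ c → Before t x y c → e = c ∨ Before t x e c := by
  classical
  have hr' : ∀ i j k, i ≠ j → i ≠ k → j ≠ k → r i j ≤ r i k → Before t i j k := by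
    intro i j k h1 h2 h3 h
    rcases Before.total ht h1 h2 h3 with h4 | h4
    · exact h4
    · have := hr _ _ _ h4
      omega
  obtain ⟨u, hu, humin⟩ := exists_min_image
    {u ∈ C | ∃ x ∈ C, y < x ∧ x < u ∧ s y x u ∧ ¬ t y x u} id
    (by obtain ⟨u, hu, h⟩ := hne; exact ⟨u, mem_filter.2 ⟨hu, h⟩⟩)
  simp only [mem_filter, id] at hu humin
  obtain ⟨x, hx, hxmax⟩ := exists_max_image
    {x ∈ C | y < x ∧ x < u ∧ s y x u ∧ ¬ t y x u} id
    (by obtain ⟨x, hx, h⟩ := hu.2; exact ⟨x, mem_filter.2 ⟨hx, h⟩⟩)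
  simp only [mem_filter, id] at hx hxmax
  obtain ⟨huC, -⟩ := hu
  obtain ⟨hxC, hyx, hxu, hsu, htu⟩ := hx
  have hyu : Before t x y u := by
    refine ⟨hyx.ne', hxu.ne, (hyx.trans hxu).ne, ?_⟩
    rw [ht.swap_left]
    exact ⟨fun _ => htu, fun _ => hyx.trans hxu⟩
  obtain ⟨e, he, hemin⟩ := exists_min_image {e | u ≤ e ∧ Before t x y e} (r x)
    ⟨u, mem_filter.2 ⟨mem_univ _, le_rfl, hyu⟩⟩
  simp only [mem_filter, mem_univ, true_and] at he hemin
  obtain ⟨hue, hye⟩ := he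
  have hfirst : ∀ c, u ≤ c → Before t x y c → e = c ∨ Before t x e c := by
    intro c hc hyc
    by_cases hec : e = c
    · exact .inl hec
    · exact .inr (hr' _ _ _ hye.2.1 hyc.2.1 hec (hemin c ⟨hc, hyc⟩))
  have hbelow : ∀ w, Before t x y w → Before t x w e → w < x := by
    intro w hyw hwe
    have hwu : w < u := by
      by_contra hcon
      have := hemin w ⟨not_lt.1 hcon, hyw⟩
      have := hr _ _ _ hwe
      omega
    by_contra hcon
    have hxw : x < w := lt_of_le_of_ne (not_lt.1 hcon) hyw.2.1
    have hwC : w ∈ C := hC u huC x hxC hyx hxu hsu htu w hyw fun c hc huc hyc => by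
      rcases hfirst c huc hyc with rfl | h
      · exact hwe
      · exact ht.trans _ _ _ _ hwe h
    have hwu' : Before t x w u := by
      rcases hfirst u le_rfl hyu with rfl | h
      · exact hwe
      · exact ht.trans _ _ _ _ hwe h
    rcases ht.split hs hyx hxw hwu htu hsu hyw hwu' with h | h
    · exact not_lt.2 (humin w ⟨hwC, x, hxC, hyx, hxw, h⟩) hwu
    · exact not_lt.2 (hxmax w ⟨hwC, hyx.trans hxw, hwu, h⟩) hxw
  obtain ⟨p, hp, hpmax⟩ := exists_max_image {p | p = y ∨ Before t x y p ∧ Before t x p e} (r x)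
    ⟨y, mem_filter.2 ⟨mem_univ _, .inl rfl⟩⟩
  simp only [mem_filter, mem_univ, true_and] at hp hpmax
  have hpe : Before t x p e := by
    rcases hp with rfl | hp
    exacts [hye, hp.2]
  have hpx : p < x := by
    rcases hp with rfl | hp
    exacts [hyx, hbelow p hp.1 hp.2]
  have hxe : x < e := hxu.trans_le hue
  refine ⟨p, x, e, hpx, hxe, ?_, ?_, ?_, hxC, hp.imp_right And.left, u, huC, hxu, hfirst⟩
  · -- in the target arrangement `e ≤ u`, `u < y` and `y ≤ p` along the line `x`
    have h1 : Before s x u y := by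
      refine ⟨hxu.ne, hyx.ne', (hyx.trans hxu).ne', ?_⟩
      rw [hs.swap_right, hs.swap_left]
      exact ⟨fun h => absurd h (hyx.trans hxu).asymm, fun h => absurd hsu h⟩
    have h2 : e = u ∨ Before s x e u := by
      rcases hfirst u le_rfl hyu with h | h
      · exact .inl h
      · refine .inr ⟨h.1, h.2.1, h.2.2.1, fun h' => absurd h' hue.not_gt, fun h' => ?_⟩
        exact h.2.2.2.2 (mt (hts _ _ _) h')
    have h3 : p = y ∨ Before s x y p := by
      refine hp.imp_right fun h => ?_
      obtain ⟨hxy, hxp, hyp, h5⟩ := h.1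
      refine ⟨hxy, hxp, hyp, fun hlt hsp => ?_, fun hsp => h5.2 (mt (hts _ _ _) hsp)⟩
      have hpC : p ∈ C := hC u huC x hxC hyx hxu hsu htu p h.1 fun c _ huc hyc => by
        rcases hfirst c huc hyc with rfl | h6
        exacts [hpe, ht.trans _ _ _ _ hpe h6]
      have htp := h5.1 hlt
      rw [ht.swap_left, ht.swap_right] at htp
      rw [hs.swap_left, hs.swap_right] at hsp
      exact not_lt.2 (humin x ⟨hxC, p, hpC, hlt, hpx, hsp, htp⟩) hxu
    have h4 : Before s x e p := by
      have h5 : Before s x e y := by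
        rcases h2 with rfl | h2
        exacts [h1, hs.trans _ _ _ _ h2 h1]
      rcases h3 with rfl | h3
      exacts [h5, hs.trans _ _ _ _ h5 h3]
    have := h4.2.2.2
    rw [hs.swap_right, hs.swap_left] at this
    by_contra hcon
    exact (hpx.trans hxe).asymm (this.2 hcon)
  · have := hpe.2.2.2
    rw [ht.swap_left] at this
    exact this.1 (hpx.trans hxe)
  · rintro w ⟨hpw, hwe⟩
    have hyw : Before t x y w := by
      rcases hp with rfl | hp
      exacts [hpw, ht.trans _ _ _ _ hp.1 hpw]
    have := hpmax w (.inr ⟨hyw, hwe⟩)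
    have := hr _ _ _ hpw
    omega

/-- If `t` is properly contained in `s`, then some triple of `s` that is not in `t` bounds an uncut
triangle of `t`. -/
theorem exists_flippable {α : Type*} [LinearOrder α] [Fintype α] {t s : α → α → α → Prop}
    (ht : IsArrangement t) (hs : IsArrangement s) (hts : ∀ i j k, t i j k → s i j k)
    (hne : ∃ a b c, a < b ∧ b < c ∧ s a b c ∧ ¬ t a b c) :
    ∃ a b c, a < b ∧ b < c ∧ s a b c ∧ ¬ t a b c ∧
      ∀ w, ¬ (Before t a b w ∧ Before t a w c) ∧ ¬ (Before t b a w ∧ Before t b w c) ∧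
        ¬ (Before t c a w ∧ Before t c w b) := by
  classical
  obtain ⟨r, K, -, hsymm, hr⟩ := ht.exists_rank univ
  replace hr : ∀ i j k, Before t i j k → r i j < r i k := by simpa using hr
  have hbase : ∃ q : α × α × α, q.1 < q.2.1 ∧ q.2.1 < q.2.2 ∧ s q.1 q.2.1 q.2.2 ∧
      ¬ t q.1 q.2.1 q.2.2 ∧ ∀ w, ¬ (Before t q.2.1 q.1 w ∧ Before t q.2.1 w q.2.2) := by
    obtain ⟨a, b, c, h⟩ := hne
    obtain ⟨p, x, e, h1, h2, h3, h4, h5, -⟩ := exists_adjacent ht hs hts hr a univ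
      ⟨c, mem_univ _, b, mem_univ _, h⟩ fun _ _ _ _ _ _ _ _ _ _ _ => mem_univ _
    exact ⟨(p, x, e), h1, h2, h3, h4, h5⟩
  obtain ⟨⟨y, x, z⟩, hq, hmin⟩ := exists_min_image
    {q : α × α × α | q.1 < q.2.1 ∧ q.2.1 < q.2.2 ∧ s q.1 q.2.1 q.2.2 ∧
      ¬ t q.1 q.2.1 q.2.2 ∧ ∀ w, ¬ (Before t q.2.1 q.1 w ∧ Before t q.2.1 w q.2.2)}
    (fun q => r q.2.1 q.2.2 - r q.2.1 q.1)
    (by obtain ⟨q, hq⟩ := hbase; exact ⟨q, mem_filter.2 ⟨mem_univ _, hq⟩⟩)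
  simp only [mem_filter, mem_univ, true_and, Prod.forall] at hq hmin
  obtain ⟨hyx, hxz, hsx, htx, hb⟩ := hq
  by_cases hW : ∃ w, Before t y x w ∧ Before t y w z
  swap
  · refine ⟨y, x, z, hyx, hxz, hsx, htx, fun w => ⟨fun h => hW ⟨w, h⟩, hb w, fun h => hW ⟨w, ?_⟩⟩⟩
    exact ht.corner_symm hyx hxz htx (hb w) h.1 h.2
  exfalso
  let C : Finset α := {w | Before t y x w ∧ (w = z ∨ Before t y w z)}
  have hyz := hyx.trans hxz
  have hxyz : Before t y x z := ⟨hyx.ne, hyz.ne, hxz.ne, fun _ => htx, fun _ => hxz⟩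
  have hzC : z ∈ C := by simp [C, hxyz]
  have hcorner : ∀ w, Before t y x w → Before t y w z → _ := fun w =>
    ht.corner hs hts hyx hxz htx hsx (hb w)
  have hCz : ∀ w ∈ C, w ≤ z := by
    intro w hw
    obtain ⟨h1, rfl | h2⟩ := (mem_filter.1 hw).2
    exacts [le_rfl, (hcorner w h1 h2).2.1.le]
  have hbefore : ∀ w ∈ C, w < z → Before t y x w ∧ Before t y w z := by
    intro w hw hwz
    obtain ⟨h1, rfl | h2⟩ := (mem_filter.1 hw).2
    exacts [absurd hwz (lt_irrefl _), ⟨h1, h2⟩]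
  have hline : ∀ m ∈ C, m < z → Before t m y z := by
    intro m hm hmz
    obtain ⟨h1, h2⟩ := hbefore m hm hmz
    obtain ⟨h3, h4, -, h5, -⟩ := hcorner m h1 h2
    refine ⟨h3.ne', h4.ne, hyz.ne, ?_⟩
    rw [ht.swap_left]
    simp [h5, hyz]
  obtain ⟨p, m, e, hpm, hme, hse, hte, hadj, hmC, hyp, u, huC, hmu, hez⟩ :=
    exists_adjacent ht hs hts hr y C (by
      obtain ⟨w, h1, h2⟩ := hW
      obtain ⟨h3, h4, h5, h6, -⟩ := hcorner w h1 h2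
      exact ⟨z, hzC, w, by simp [C, h1, h2], h3, h4, h5, h6⟩) (by
      intro u huC m hmC hym hmu hsu htu w hyw hwc
      have hmz := hmu.trans_le (hCz u huC)
      obtain ⟨h1, h2⟩ := hbefore m hmC hmz
      obtain ⟨-, -, h3, h4, h5, h6⟩ := hcorner m h1 h2
      have hwz := hwc z hzC (hCz u huC) (hline m hmC hmz)
      refine mem_filter.2 ⟨mem_univ _, ?_⟩
      rcases ht.pasch hym hmz h4 hyw hwz with ⟨h7, h8⟩ | ⟨h7, h8⟩
      · exact ⟨ht.trans _ _ _ _ h1 h7, .inr h8⟩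
      · obtain ⟨h9, h10⟩ :=
          ht.corner_symm hyx hxz htx (hb w) h7 (ht.trans _ _ _ _ h8 h5)
        exact ⟨h9, .inr h10⟩)
  have hmz := hmu.trans_le (hCz u huC)
  obtain ⟨h1, h2⟩ := hbefore m hmC hmz
  obtain ⟨hym, -, h3, h4, h5, h6⟩ := hcorner m h1 h2
  have hle := hmin p m e ⟨hpm, hme, hse, hte, hadj⟩
  have k1 := hr _ _ _ h1
  have k2 := hr _ _ _ h5
  have k3 : r m y ≤ r m p := by
    rcases hyp with rfl | h
    exacts [le_rfl, (hr _ _ _ h).le]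
  have k4 : r m e ≤ r m z := by
    rcases hez z (hCz u huC) (hline m hmC hmz) with rfl | h
    exacts [le_rfl, (hr _ _ _ h).le]
  have k5 : r m p < r m e := by
    refine hr _ _ _ ⟨hpm.ne', hme.ne, (hpm.trans hme).ne, ?_⟩
    rw [ht.swap_left]
    simp [hte, hpm.trans hme]
  have := hsymm y x
  have := hsymm y m
  have := hsymm z x
  have := hsymm z m
  omega

/-- An arrangement stays one after inverting a triple `P` whose members are adjacent on each of its
three lines. -/
theorem IsArrangement.flip {α : Type*} [LinearOrder α] {t P : α → α → α → Prop}
    (ht : IsArrangement t) (hl : ∀ i j k, P i j k ↔ P j i k) (hr : ∀ i j k, P i j k ↔ P i k j)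
    (hP : ∀ i a b c, P i a b → P i b c → a = c) (hPt : ∀ i j k, P i j k → ¬ t i j k)
    (hadj : ∀ i j k w, P i j k → ¬ (Before t i j w ∧ Before t i w k)) :
    IsArrangement fun i j k => t i j k ∨ P i j k := by
  have key : ∀ i j k, Before (fun i j k => t i j k ∨ P i j k) i j k ↔
      (P i j k ∧ Before t i k j) ∨ (¬ P i j k ∧ Before t i j k) := by
    intro i j k
    have := hPt i j k
    have := ht.swap_right i j k
    unfold Before
    grind
  refine ⟨fun i j k => by rw [ht.swap_left, hl], fun i j k => by rw [ht.swap_right, hr], ?_⟩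
  intro i a b c hab hbc
  rw [key] at hab hbc ⊢
  rcases eq_or_ne a c with rfl | hac
  · have := hr i a b
    rcases hab with ⟨h1, h2⟩ | ⟨h1, h2⟩ <;> rcases hbc with ⟨h3, h4⟩ | ⟨h3, h4⟩
    · exact absurd h4 (h2.asymm ht)
    · exact absurd (this.1 h1) h3
    · exact absurd (this.2 h3) h1
    · exact absurd h4 (h2.asymm ht)
  rcases hab with ⟨h1, h2⟩ | ⟨h1, h2⟩ <;> rcases hbc with ⟨h3, h4⟩ | ⟨h3, h4⟩
  · exact absurd (hP _ _ _ _ h1 h3) hac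
  · refine .inr ⟨fun h => h3 ?_, ?_⟩
    · cases hP i b a c ((hr _ _ _).1 h1) h
      exact absurd rfl h4.2.2.1
    · refine (Before.total ht h2.2.1 h4.2.1 hac).resolve_right fun h => ?_
      exact hadj i b a c ((hr _ _ _).1 h1) ⟨h4, h⟩
  · refine .inr ⟨fun h => h1 ?_, ?_⟩
    · cases hP i a c b h ((hr _ _ _).1 h3)
      exact absurd rfl h2.2.2.1
    · refine (Before.total ht h2.1 h4.1 hac).resolve_right fun h => ?_
      exact hadj i c b a ((hr _ _ _).1 h3) ⟨h, h2⟩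
  · exact .inr ⟨fun h => hadj i a c b h ⟨h2, h4⟩, ht.trans _ _ _ _ h2 h4⟩

theorem triple_mem_binom {n i j k : ℕ} (hi : i ∈ _root_.box n) (hj : j ∈ _root_.box n)
    (hk : k ∈ _root_.box n)
    (hij : i ≠ j) (hik : i ≠ k) (hjk : j ≠ k) : ({i, j, k} : Finset ℕ) ∈ binom n 3 := by
  refine mem_powersetCard.2 ⟨?_, card_eq_three.2 ⟨i, j, k, hij, hik, hjk, rfl⟩⟩
  simp [insert_subset_iff, hi, hj, hk]

/-- Consistent sets of triples are the inversion sets of arrangements. -/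
theorem consistent_two_iff {n : ℕ} {X : Finset (Finset ℕ)} :
    Consistent n 2 X ↔ X ⊆ binom n 3 ∧
      IsArrangement fun i j k : _root_.box n => ({(i : ℕ), (j : ℕ), (k : ℕ)} : Finset ℕ) ∈ X := by
  have hl : ∀ i j k : ℕ, ({i, j, k} : Finset ℕ) = {j, i, k} := fun i j k => insert_comm _ _ _
  have hr : ∀ i j k : ℕ, ({i, j, k} : Finset ℕ) = {i, k, j} := fun i j k => by
    rw [pair_comm]
  refine and_congr_right fun hX => ⟨fun ⟨h1, h2⟩ => ?_, fun h => ?_⟩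
  · have hI : ∀ i : _root_.box n, {(i : ℕ)} ∈ binom n (2 - 1) := fun i => by
      simp [binom, mem_powersetCard]
    have c1 : ∀ i a b c : _root_.box n, i ≠ a → i ≠ b → i ≠ c → a < b → b < c →
        ({(i : ℕ), (a : ℕ), (b : ℕ)} : Finset ℕ) ∈ X →
        ({(i : ℕ), (b : ℕ), (c : ℕ)} : Finset ℕ) ∈ X →
        ({(i : ℕ), (a : ℕ), (c : ℕ)} : Finset ℕ) ∈ X := by
      intro i a b c hia hib hic hab hbc
      exact h1 {(i : ℕ)} (hI i) a a.2 b b.2 c c.2 (by simpa using Subtype.coe_ne_coe.2 hia.symm)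
        (by simpa using Subtype.coe_ne_coe.2 hib.symm)
        (by simpa using Subtype.coe_ne_coe.2 hic.symm) hab hbc
    have c2 : ∀ i a b c : _root_.box n, i ≠ a → i ≠ b → i ≠ c → a < b → b < c →
        ({(i : ℕ), (a : ℕ), (b : ℕ)} : Finset ℕ) ∉ X →
        ({(i : ℕ), (b : ℕ), (c : ℕ)} : Finset ℕ) ∉ X →
        ({(i : ℕ), (a : ℕ), (c : ℕ)} : Finset ℕ) ∉ X := by
      intro i a b c hia hib hic hab hbc hX1 hX2
      have hm : ∀ j k : _root_.box n, i ≠ j → i ≠ k → j < k →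
          ({(i : ℕ), (j : ℕ), (k : ℕ)} : Finset ℕ) ∈ binom n 3 := fun j k hij hik hjk =>
        triple_mem_binom i.2 j.2 k.2 (Subtype.coe_ne_coe.2 hij) (Subtype.coe_ne_coe.2 hik)
          (Subtype.coe_ne_coe.2 hjk.ne)
      exact (mem_sdiff.1 (h2 {(i : ℕ)} (hI i) a a.2 b b.2 c c.2
        (by simpa using Subtype.coe_ne_coe.2 hia.symm)
        (by simpa using Subtype.coe_ne_coe.2 hib.symm)
        (by simpa using Subtype.coe_ne_coe.2 hic.symm) hab hbc
        (mem_sdiff.2 ⟨hm a b hia hib hab, hX1⟩) (mem_sdiff.2 ⟨hm b c hib hic hbc, hX2⟩))).2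
    refine ⟨fun i j k => by rw [hl], fun i j k => by rw [hr], ?_⟩
    rintro i a b c ⟨hia, hib, hab, h3⟩ ⟨-, hic, hbc, h4⟩
    have e1 := hr i a b
    have e2 := hr i b c
    have e3 := hr i a c
    rcases eq_or_ne a c with rfl | hac
    · grind
    refine ⟨hia, hic, hac, ?_⟩
    have p1 := c1 i a b c hia hib hic
    have p2 := c1 i a c b hia hic hib
    have p3 := c1 i b a c hib hia hic
    have p4 := c1 i b c a hib hic hia
    have p5 := c1 i c a b hic hia hib
    have p6 := c1 i c b a hic hib hia
    have q1 := c2 i a b c hia hib hic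
    have q2 := c2 i a c b hia hic hib
    have q3 := c2 i b a c hib hia hic
    have q4 := c2 i b c a hib hic hia
    have q5 := c2 i c a b hic hia hib
    have q6 := c2 i c b a hic hib hia
    simp only [← e1, ← e2, ← e3] at p2 p3 p4 p5 p6 q2 q3 q4 q5 q6
    beta_reduce at h3 h4 ⊢
    clear e1 e2 e3 c1 c2 hl hr hI h1 h2 hX hia hib hic
    generalize (({(i : ℕ), (a : ℕ), (b : ℕ)} : Finset ℕ) ∈ X) = A at *
    generalize (({(i : ℕ), (b : ℕ), (c : ℕ)} : Finset ℕ) ∈ X) = B at *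
    generalize (({(i : ℕ), (a : ℕ), (c : ℕ)} : Finset ℕ) ∈ X) = C at *
    rcases lt_or_gt_of_ne hab with h | h <;> rcases lt_or_gt_of_ne hbc with h' | h' <;>
      rcases lt_or_gt_of_ne hac with h'' | h'' <;> grind
  · have key : ∀ x ∈ _root_.box n, ∀ i ∈ _root_.box n, ∀ j ∈ _root_.box n, ∀ k ∈ _root_.box n,
        i ≠ x → j ≠ x → k ≠ x → i < j → j < k →
        (({x, i, j} : Finset ℕ) ∈ X → ({x, j, k} : Finset ℕ) ∈ X → ({x, i, k} : Finset ℕ) ∈ X) ∧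
        (({x, i, j} : Finset ℕ) ∉ X → ({x, j, k} : Finset ℕ) ∉ X →
          ({x, i, k} : Finset ℕ) ∉ X) := by
      intro x hx i hi j hj k hk hix hjx hkx hij hjk
      have e1 := hr x j i
      have e2 := hr x k j
      have e3 := hr x k i
      have t1 := h.trans ⟨x, hx⟩ ⟨k, hk⟩ ⟨j, hj⟩ ⟨i, hi⟩
      have t2 := h.trans ⟨x, hx⟩ ⟨i, hi⟩ ⟨j, hj⟩ ⟨k, hk⟩
      simp only [Before, ne_eq, Subtype.mk.injEq, Subtype.mk_lt_mk] at t1 t2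
      rw [e1, e2, e3] at t1
      clear hl hr e1 e2 e3 hX h
      constructor <;> intro h1 h2
      · have := t1 ⟨by omega, by omega, by omega, by simp [h2]; omega⟩
          ⟨by omega, by omega, by omega, by simp [h1]; omega⟩
        by_contra h3
        have := this.2.2.2.2 h3
        omega
      · exact (t2 ⟨by omega, by omega, by omega, by simp [h1, hij]⟩
          ⟨by omega, by omega, by omega, by simp [h2, hjk]⟩).2.2.2.1 (hij.trans hjk)
    have hI : ∀ I ∈ binom n (2 - 1), ∃ x ∈ _root_.box n, I = {x} := by
      intro I hI
      obtain ⟨x, rfl⟩ := card_eq_one.1 (mem_powersetCard.1 hI).2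
      exact ⟨x, (mem_powersetCard.1 hI).1 (mem_singleton_self x), rfl⟩
    constructor
    · intro I hI' i hi j hj k hk hiI hjI hkI hij hjk
      obtain ⟨x, hx, rfl⟩ := hI I hI'
      rw [mem_singleton] at hiI hjI hkI
      exact (key x hx i hi j hj k hk hiI hjI hkI hij hjk).1
    · intro I hI' i hi j hj k hk hiI hjI hkI hij hjk h1 h2
      obtain ⟨x, hx, rfl⟩ := hI I hI'
      rw [mem_singleton] at hiI hjI hkI
      refine mem_sdiff.2 ⟨triple_mem_binom hx hi hk (Ne.symm hiI) (Ne.symm hkI)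
        (hij.trans hjk).ne, ?_⟩
      exact (key x hx i hi j hj k hk hiI hjI hkI hij hjk).2 (mem_sdiff.1 h1).2 (mem_sdiff.1 h2).2

theorem exists_sorted_triple {α : Type*} [LinearOrder α] {s : Finset α} (hs : s.card = 3) :
    ∃ a b c, a < b ∧ b < c ∧ s = {a, b, c} := by
  obtain ⟨x, y, z, hxy, hxz, hyz, rfl⟩ := card_eq_three.1 hs
  have h1 := insert_comm x y {z}
  have h2 := pair_comm y z
  have h3 := pair_comm x z
  have h4 := pair_comm x y
  have h5 := insert_comm x z {y}
  have h6 := insert_comm y z {x}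
  rcases lt_or_gt_of_ne hxy with h | h <;> rcases lt_or_gt_of_ne hxz with h' | h' <;>
    rcases lt_or_gt_of_ne hyz with h'' | h''
  · exact ⟨x, y, z, h, h'', rfl⟩
  · exact ⟨x, z, y, h', h'', by rw [h2]⟩
  · exact absurd (h.trans h'') h'.not_gt
  · exact ⟨z, x, y, h', h, by rw [h2, h5]⟩
  · exact ⟨y, x, z, h, h', by rw [h1]⟩
  · exact absurd (h.trans h') h''.not_gt
  · exact ⟨y, z, x, h'', h', by rw [h1, h3]⟩
  · exact ⟨z, y, x, h'', h, by rw [h1, h3, h6]⟩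

/-- A consistent set properly contained in another one can be enlarged by a single triple of the
larger one to a consistent set. -/
theorem Consistent.exists_insert {n : ℕ} {X Y : Finset (Finset ℕ)} (hX : Consistent n 2 X)
    (hY : Consistent n 2 Y) (hXY : X ⊂ Y) : ∃ T ∈ Y \ X, Consistent n 2 (insert T X) := by
  obtain ⟨hXb, ht⟩ := consistent_two_iff.1 hX
  obtain ⟨hYb, hs⟩ := consistent_two_iff.1 hY
  obtain ⟨T₀, hTY, hTX⟩ := exists_of_ssubset hXY
  obtain ⟨hTb, hTc⟩ := mem_powersetCard.1 (hYb hTY)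
  obtain ⟨a, b, c, hab, hbc, rfl⟩ := exists_sorted_triple hTc
  have hmem : a ∈ _root_.box n ∧ b ∈ _root_.box n ∧ c ∈ _root_.box n := by
    simpa [insert_subset_iff] using hTb
  obtain ⟨a, b, c, hab, hbc, hTY, hTX, hadj⟩ := exists_flippable ht hs
    (fun i j k h => hXY.subset h) ⟨⟨a, hmem.1⟩, ⟨b, hmem.2.1⟩, ⟨c, hmem.2.2⟩, hab, hbc, hTY, hTX⟩
  have htriple : ∀ i j k : _root_.box n,
      ({(i : ℕ), (j : ℕ), (k : ℕ)} : Finset ℕ) = {(a : ℕ), ↑b, ↑c} →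
      (i = a ∧ j = b ∧ k = c) ∨ (i = a ∧ j = c ∧ k = b) ∨ (i = b ∧ j = a ∧ k = c) ∨
      (i = b ∧ j = c ∧ k = a) ∨ (i = c ∧ j = a ∧ k = b) ∨ (i = c ∧ j = b ∧ k = a) := by
    intro i j k h
    have ha : (a : ℕ) ∈ ({(i : ℕ), ↑j, ↑k} : Finset ℕ) := by simp [h]
    have hb : (b : ℕ) ∈ ({(i : ℕ), ↑j, ↑k} : Finset ℕ) := by simp [h]
    have hc : (c : ℕ) ∈ ({(i : ℕ), ↑j, ↑k} : Finset ℕ) := by simp [h]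
    simp only [mem_insert, mem_singleton, ← Subtype.ext_iff] at ha hb hc
    have h1 := hab.ne
    have h2 := hbc.ne
    have h3 := (hab.trans hbc).ne
    clear hadj ht hs hTY hTX h
    rcases ha with rfl | rfl | rfl <;> rcases hb with rfl | rfl | rfl <;>
      rcases hc with rfl | rfl | rfl <;> simp at h1 h2 h3 ⊢
  have hl : ∀ i j k : ℕ, ({i, j, k} : Finset ℕ) = {j, i, k} := fun i j k => insert_comm _ _ _
  have hr : ∀ i j k : ℕ, ({i, j, k} : Finset ℕ) = {i, k, j} := fun i j k => by rw [pair_comm]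
  have hflip := ht.flip (P := fun i j k : _root_.box n =>
      ({(i : ℕ), (j : ℕ), (k : ℕ)} : Finset ℕ) = {↑a, ↑b, ↑c})
    (fun i j k => by rw [hl]) (fun i j k => by rw [hr])
    (fun i x y z h1 h2 => by
      have h1 := htriple _ _ _ h1
      have h2 := htriple _ _ _ h2
      have := hab.ne
      have := hbc.ne
      have := (hab.trans hbc).ne
      clear htriple hadj ht hs hTY hTX hl hr
      grind)
    (fun i j k h => by rwa [h])
    (fun i j k w h => by
      have hac := hab.trans hbc
      have hba : ({(b : ℕ), ↑a, ↑c} : Finset ℕ) ∉ X := by rwa [hl]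
      have hca : ({(c : ℕ), ↑a, ↑b} : Finset ℕ) ∉ X := by rwa [hl, hr ↑a]
      have B1 : Before (fun i j k : _root_.box n =>
          ({(i : ℕ), (j : ℕ), (k : ℕ)} : Finset ℕ) ∈ X) a b c :=
        ⟨hab.ne, hac.ne, hbc.ne, by simp [hbc, hTX]⟩
      have B2 : Before (fun i j k : _root_.box n =>
          ({(i : ℕ), (j : ℕ), (k : ℕ)} : Finset ℕ) ∈ X) b a c :=
        ⟨hab.ne', hbc.ne, hac.ne, by simp [hac, hba]⟩
      have B3 : Before (fun i j k : _root_.box n =>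
          ({(i : ℕ), (j : ℕ), (k : ℕ)} : Finset ℕ) ∈ X) c a b :=
        ⟨hac.ne', hbc.ne', hab.ne, by simp [hab, hca]⟩
      rcases htriple _ _ _ h with ⟨rfl, rfl, rfl⟩ | ⟨rfl, rfl, rfl⟩ | ⟨rfl, rfl, rfl⟩ |
        ⟨rfl, rfl, rfl⟩ | ⟨rfl, rfl, rfl⟩ | ⟨rfl, rfl, rfl⟩
      · exact (hadj w).1
      · exact fun h => B1.asymm ht (ht.trans _ _ _ _ h.1 h.2)
      · exact (hadj w).2.1
      · exact fun h => B2.asymm ht (ht.trans _ _ _ _ h.1 h.2)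
      · exact (hadj w).2.2
      · exact fun h => B3.asymm ht (ht.trans _ _ _ _ h.1 h.2))
  refine ⟨_, mem_sdiff.2 ⟨hTY, hTX⟩, consistent_two_iff.2
    ⟨insert_subset (hYb hTY) hXb, ?_⟩⟩
  convert hflip using 4 with i j k
  rw [mem_insert, or_comm]

theorem SingleStepLE.subset {n : ℕ} {X Y : Finset (Finset ℕ)} (h : SingleStepLE n X Y) :
    X ⊆ Y := by
  obtain ⟨t, c, rfl, rfl, -, hc⟩ := h
  have : ∀ i ≤ t, c 0 ⊆ c i := fun i => by
    induction i with
    | zero => exact fun _ => Subset.rfl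
    | succ i ih => exact fun hi => (ih (by omega)).trans (hc i (by omega)).1
  exact this t le_rfl

theorem SingleStepLE.refl {n : ℕ} {X : Finset (Finset ℕ)} (hX : Consistent n 2 X) :
    SingleStepLE n X X :=
  ⟨0, fun _ => X, rfl, rfl, fun _ _ => hX, fun _ hi => absurd hi (Nat.not_lt_zero _)⟩

theorem SingleStepLE.of_insert {n : ℕ} {T : Finset ℕ} {X Y : Finset (Finset ℕ)}
    (hX : Consistent n 2 X) (hT : T ∉ X) (h : SingleStepLE n (insert T X) Y) :
    SingleStepLE n X Y := by
  obtain ⟨t, c, h0, ht, hcons, hc⟩ := h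
  refine ⟨t + 1, fun i => Nat.casesOn i X c, rfl, ht, ?_, ?_⟩
  · rintro (_ | i) hi
    · exact hX
    · exact hcons i (by omega)
  · rintro (_ | i) hi
    · change X ⊆ c 0 ∧ (c 0 \ X).card = 1
      rw [h0, insert_sdiff_of_notMem _ hT, sdiff_self]
      exact ⟨subset_insert _ _, rfl⟩
    · exact hc i (by omega)

theorem Consistent.singleStepLE_of_subset {n : ℕ} {X Y : Finset (Finset ℕ)}
    (hX : Consistent n 2 X) (hY : Consistent n 2 Y) (hXY : X ⊆ Y) : SingleStepLE n X Y := by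
  induction h : (Y \ X).card generalizing X with
  | zero =>
    obtain rfl := hXY.antisymm (sdiff_eq_empty_iff_subset.1 (card_eq_zero.1 h))
    exact .refl hX
  | succ m ih =>
    have hne : X ≠ Y := by
      rintro rfl
      simp at h
    obtain ⟨T, hT, hTX⟩ := hX.exists_insert hY (hXY.ssubset_of_ne hne)
    obtain ⟨hTY, hTn⟩ := mem_sdiff.1 hT
    refine .of_insert hX hTn (ih hTX (insert_subset hTY hXY) ?_)
    rw [sdiff_insert, card_erase_of_mem hT, h, Nat.add_sub_cancel]

/-- The second higher Bruhat order `B(n,2)` coincides with the inclusion order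
`B_⊆(n,2)`. -/
theorem singleStep_iff_subset (n : ℕ) (hn : 1 ≤ n) (X Y : Finset (Finset ℕ))
    (hX : Consistent n 2 X) (hY : Consistent n 2 Y) :
    SingleStepLE n X Y ↔ X ⊆ Y := by
  exact ⟨SingleStepLE.subset, hX.singleStepLE_of_subset hY⟩
end

section
/- Let n, d ∈ ℕ with d ≥ 1, let X be a consistent subset of binom([n], d+1), and let I, J ∈ Asc(X) be distinct ascents with |I ∩ J| = d, with I preceding J in lexicographic order. Then P = I ∪ J has d+2 elements, and I = P ∖ {max P} and J = P ∖ {min P}; that is, I is the lexicographically minimal and J the lexicographically maximal (d+1)-element subset of P. -/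
open Finset

/-- Lexicographic order on finite subsets of `ℕ` (viewed as increasing tuples):
`I < J` iff the smallest element of the symmetric difference lies in `I`. -/
def LexLT (I J : Finset ℕ) : Prop :=
  ∃ m, m ∈ I ∧ m ∉ J ∧ ∀ x, x < m → (x ∈ I ↔ x ∈ J)

/-- In terms of the facets `P.erase p` of a `(d+2)`-element set `P`, a closed set is convex. -/
theorem IsClosedSet.erase_mem {n d : ℕ} {Y : Finset (Finset ℕ)} (hY : IsClosedSet n d Y)
    (hd : 1 ≤ d) {P : Finset ℕ} (hP : P ⊆ box n) (hcard : P.card = d + 2) {i j k : ℕ}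
    (hi : i ∈ P) (hj : j ∈ P) (hk : k ∈ P) (hij : i < j) (hjk : j < k)
    (hiY : P.erase i ∈ Y) (hkY : P.erase k ∈ Y) : P.erase j ∈ Y := by
  have hmem : ((P.erase i).erase j).erase k ∈ binom n (d - 1) := by
    refine mem_powersetCard.2 ⟨fun x hx => hP (by grind), ?_⟩
    rw [card_erase_of_mem (by grind), card_erase_of_mem (by grind), card_erase_of_mem hi]
    omega
  have hclosed := hY _ hmem i (hP hi) j (hP hj) k (hP hk) (by grind) (by grind) (by grind) hij hjk
  rw [show ((P.erase i).erase j).erase k ∪ {i, j} = P.erase k by grind,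
    show ((P.erase i).erase j).erase k ∪ {j, k} = P.erase i by grind,
    show ((P.erase i).erase j).erase k ∪ {i, k} = P.erase j by grind] at hclosed
  exact hclosed hkY hiY

/-- Facets outside a consistent set also form a convex family. -/
theorem Consistent.erase_notMem {n d : ℕ} {Y : Finset (Finset ℕ)} (hY : Consistent n d Y)
    (hd : 1 ≤ d) {P : Finset ℕ} (hP : P ⊆ box n) (hcard : P.card = d + 2) {i j k : ℕ}
    (hi : i ∈ P) (hj : j ∈ P) (hk : k ∈ P) (hij : i < j) (hjk : j < k)
    (hiY : P.erase i ∉ Y) (hkY : P.erase k ∉ Y) : P.erase j ∉ Y := by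
  have hbinom : ∀ p ∈ P, P.erase p ∈ binom n (d + 1) := fun p hp =>
    mem_powersetCard.2 ⟨(erase_subset p P).trans hP, by rw [card_erase_of_mem hp]; omega⟩
  exact (mem_sdiff.1 (hY.2.2.erase_mem hd hP hcard hi hj hk hij hjk
    (mem_sdiff.2 ⟨hbinom i hi, hiY⟩) (mem_sdiff.2 ⟨hbinom k hk, hkY⟩))).2

/-- If `I, J` are distinct ascents of a consistent set `X ⊆ binom([n],d+1)` with
`|I ∩ J| = d` and `I` lexicographically smaller than `J`, then `P = I ∪ J` has
`d+2` elements, `I = P ∖ {max P}` and `J = P ∖ {min P}`. -/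
theorem ascents_sharing_d (n d : ℕ) (hd : 1 ≤ d) (X : Finset (Finset ℕ))
    (hX : Consistent n d X) (I J : Finset ℕ)
    (hI : I ∈ ascSet n d X (binom n (d + 1)))
    (hJ : J ∈ ascSet n d X (binom n (d + 1)))
    (hne : I ≠ J) (hcap : (I ∩ J).card = d) (hlex : LexLT I J) :
    (I ∪ J).card = d + 2 ∧
    (∃ b ∈ I ∪ J, (∀ x ∈ I ∪ J, x ≤ b) ∧ I = (I ∪ J).erase b) ∧
    (∃ a ∈ I ∪ J, (∀ x ∈ I ∪ J, a ≤ x) ∧ J = (I ∪ J).erase a) := by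
  classical
  simp only [ascSet, mem_filter, mem_sdiff] at hI hJ
  obtain ⟨⟨hIb, hIX⟩, hIc⟩ := hI
  obtain ⟨⟨hJb, hJX⟩, hJc⟩ := hJ
  obtain ⟨hIn, hIcard⟩ := mem_powersetCard.1 hIb
  obtain ⟨hJn, hJcard⟩ := mem_powersetCard.1 hJb
  have hPcard : (I ∪ J).card = d + 2 := by
    have := card_union_add_card_inter I J
    omega
  have hPn : I ∪ J ⊆ box n := union_subset hIn hJn
  obtain ⟨a, haI, haJ, hlow⟩ := hlex
  have haP : a ∈ I ∪ J := mem_union_left _ haI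
  have hJe : J = (I ∪ J).erase a :=
    eq_of_subset_of_card_le (fun x hx => by grind) (by rw [card_erase_of_mem haP]; omega)
  obtain ⟨b, hbJ, hbI⟩ : ∃ b ∈ J, b ∉ I := by
    by_contra! h
    exact hne (eq_of_subset_of_card_le h (by omega)).symm
  have hbP : b ∈ I ∪ J := mem_union_right _ hbJ
  have hIe : I = (I ∪ J).erase b :=
    eq_of_subset_of_card_le (fun x hx => by grind) (by rw [card_erase_of_mem hbP]; omega)
  have hab : a < b := by
    rcases lt_trichotomy a b with h | h | h
    · exact h
    · exact absurd (h ▸ haI) hbI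
    · exact absurd ((hlow b h).2 hbJ) hbI
  generalize I ∪ J = P at *
  subst hIe hJe
  have herase : ∀ x ∈ P, ∀ y, P.erase x = P.erase y → x = y := fun x hx y h => by
    by_contra hxy
    exact notMem_erase x P (h ▸ mem_erase.2 ⟨hxy, hx⟩)
  have hmem : ∀ y, ∀ x ∈ P, P.erase x ∈ X ∪ {P.erase y} ↔ P.erase x ∈ X ∨ x = y :=
    fun y x hx => by
      rw [mem_union, mem_singleton]
      exact or_congr_right ⟨herase x hx y, fun h => h ▸ rfl⟩
  refine ⟨hPcard, ⟨b, hbP, fun x hx => ?_, rfl⟩, ⟨a, haP, fun x hx => ?_, rfl⟩⟩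
  · by_contra! hbx
    by_cases hxX : P.erase x ∈ X
    · have := hJc.2.1.erase_mem hd hPn hPcard haP hbP hx hab hbx
      grind
    · have := hIc.erase_notMem hd hPn hPcard haP hbP hx hab hbx
      grind
  · by_contra! hxa
    by_cases hxX : P.erase x ∈ X
    · have := hIc.2.1.erase_mem hd hPn hPcard hx haP hbP hxa hab
      grind
    · have := hJc.erase_notMem hd hPn hPcard hx haP hbP hxa hab
      grind
end

section
/- Let n, d ∈ ℕ with d ≥ 1, let X be a consistent subset of binom([n], d+1), and let I ∈ Asc(X). Then there is at most one J ∈ Asc(X) with |I ∩ J| = d and J lexicographically greater than I, and at most one L ∈ Asc(X) with |I ∩ L| = d and L lexicographically smaller than I. In particular, at most two elements J ∈ Asc(X) with J ≠ I satisfy |I ∩ J| = d. -/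
open Finset

theorem mem_ascSet {n d : ℕ} {X Y : Finset (Finset ℕ)} {I : Finset ℕ} :
    I ∈ ascSet n d X Y ↔ (I ∈ Y ∧ I ∉ X) ∧ Consistent n d (X ∪ {I}) := by
  classical
  simp [ascSet]

/-- A consistent set and its complement, read on one triple `i < j < k` of a packet. -/
theorem Consistent.triple {n d : ℕ} {Y : Finset (Finset ℕ)} (hY : Consistent n d Y)
    {I : Finset ℕ} (hI : I ∈ binom n (d - 1)) {i j k : ℕ} (hi : i ∈ box n) (hj : j ∈ box n)
    (hk : k ∈ box n) (hiI : i ∉ I) (hjI : j ∉ I) (hkI : k ∉ I) (hij : i < j) (hjk : j < k)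
    (p : I ∪ {i, j} ∈ binom n (d + 1))
    (r : I ∪ {j, k} ∈ binom n (d + 1)) :
    (I ∪ {i, j} ∈ Y → I ∪ {j, k} ∈ Y → I ∪ {i, k} ∈ Y) ∧
      (I ∪ {i, k} ∈ Y → I ∪ {i, j} ∈ Y ∨ I ∪ {j, k} ∈ Y) := by
  refine ⟨hY.2.1 I hI i hi j hj k hk hiI hjI hkI hij hjk, fun h => ?_⟩
  by_contra! hc
  exact (mem_sdiff.1 (hY.2.2 I hI i hi j hj k hk hiI hjI hkI hij hjk
    (mem_sdiff.2 ⟨p, hc.1⟩) (mem_sdiff.2 ⟨r, hc.2⟩))).2 h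

/-- Within a triple of a packet, the middle element is never an ascent together with
one of the outer elements. -/
theorem not_mem_ascSet_of_triple {n d : ℕ} (hd : 1 ≤ d) {X : Finset (Finset ℕ)}
    {I : Finset ℕ} (hI : I ∈ binom n (d - 1)) {i j k : ℕ}
    (hi : i ∈ box n) (hj : j ∈ box n) (hk : k ∈ box n) (hiI : i ∉ I) (hjI : j ∉ I) (hkI : k ∉ I)
    (hij : i < j) (hjk : j < k) (hq : I ∪ {i, k} ∈ ascSet n d X (binom n (d + 1))) :
    I ∪ {i, j} ∉ ascSet n d X (binom n (d + 1)) ∧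
      I ∪ {j, k} ∉ ascSet n d X (binom n (d + 1)) := by
  have mem : ∀ a ∈ box n, ∀ b ∈ box n, a ∉ I → b ∉ I → a < b →
      I ∪ {a, b} ∈ binom n (d + 1) := by
    intro a ha b hb haI hbI hab
    obtain ⟨hs, hc⟩ := mem_powersetCard.1 hI
    refine mem_powersetCard.2 ⟨?_, ?_⟩
    · intro x hx
      simp only [mem_union, mem_insert, mem_singleton] at hx
      rcases hx with hx | rfl | rfl
      exacts [hs hx, ha, hb]
    · rw [card_union_of_disjoint (by simp [haI, hbI]), card_pair hab.ne, hc]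
      omega
  have T := fun {Y} (hY : Consistent n d Y) => hY.triple hI hi hj hk hiI hjI hkI hij hjk
    (mem i hi j hj hiI hjI hij)
    (mem j hj k hk hjI hkI hjk)
  have pq : I ∪ {i, j} ≠ I ∪ {i, k} := fun h => by
    have := h ▸ (show j ∈ I ∪ {i, j} by simp)
    simp at this
    grind
  have qr : I ∪ {i, k} ≠ I ∪ {j, k} := fun h => by
    have := h ▸ (show i ∈ I ∪ {i, k} by simp)
    simp at this
    grind
  have pr : I ∪ {i, j} ≠ I ∪ {j, k} := fun h => by
    have := h ▸ (show i ∈ I ∪ {i, j} by simp)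
    simp at this
    grind
  rw [mem_ascSet] at hq
  have Tq := T hq.2
  constructor <;> intro h <;> rw [mem_ascSet] at h <;> have Th := T h.2 <;>
    simp only [mem_union, mem_singleton] at Tq Th <;> grind

/-- If two ascents share the `d`-set `S`, then `S` lies strictly between the two
remaining elements. -/
theorem between_of_mem_ascSet {n d : ℕ} (hd : 1 ≤ d) {X : Finset (Finset ℕ)} {S : Finset ℕ}
    (hS : S.card = d) {a b : ℕ} (ha : a ∉ S) (hb : b ∉ S) (hab : a < b)
    (hA : insert a S ∈ ascSet n d X (binom n (d + 1)))
    (hB : insert b S ∈ ascSet n d X (binom n (d + 1))) {c : ℕ} (hc : c ∈ S) :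
    a < c ∧ c < b := by
  have sA := (mem_powersetCard.1 (mem_ascSet.1 hA).1.1).1
  have sB := (mem_powersetCard.1 (mem_ascSet.1 hB).1.1).1
  have hI : S.erase c ∈ binom n (d - 1) := mem_powersetCard.2
    ⟨fun x hx => sA (mem_insert_of_mem (mem_of_mem_erase hx)), by rw [card_erase_of_mem hc, hS]⟩
  have han : a ∈ box n := sA (mem_insert_self _ _)
  have hbn : b ∈ box n := sB (mem_insert_self _ _)
  have hcn : c ∈ box n := sA (mem_insert_of_mem hc)
  have haI : a ∉ S.erase c := fun h => ha (mem_of_mem_erase h)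
  have hbI : b ∉ S.erase c := fun h => hb (mem_of_mem_erase h)
  have hcI : c ∉ S.erase c := notMem_erase c S
  have e1 : ∀ x, insert x S = S.erase c ∪ {x, c} := by intro x; ext y; simp; grind
  have e2 : ∀ x, insert x S = S.erase c ∪ {c, x} := by intro x; ext y; simp; grind
  have hac : a ≠ c := by rintro rfl; exact ha hc
  have hbc : b ≠ c := by rintro rfl; exact hb hc
  constructor
  · by_contra h
    have hca : c < a := by omega
    rw [e2] at hA hB
    exact (not_mem_ascSet_of_triple hd hI hcn han hbn hcI haI hbI hca hab hB).1 hA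
  · by_contra h
    have hbc' : b < c := by omega
    rw [e1] at hA hB
    exact (not_mem_ascSet_of_triple hd hI han hbn hcn haI hbI hcI hab hbc' hA).2 hB

theorem exists_eq_insert_inter {A B : Finset ℕ} {d : ℕ} (hA : A.card = d + 1)
    (h : (A ∩ B).card = d) : ∃ a, a ∉ B ∧ A = insert a (A ∩ B) := by
  have hc : (A \ B).card = 1 := by
    have := card_sdiff_add_card_inter A B
    omega
  obtain ⟨a, ha⟩ := card_eq_one.1 hc
  refine ⟨a, (mem_sdiff.1 (ha ▸ mem_singleton_self a)).2, ?_⟩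
  rw [insert_eq, ← ha, sdiff_union_inter]

/-- Two ascents sharing `d` elements differ by exchanging an element. -/
theorem exists_exchange {n d : ℕ} {X : Finset (Finset ℕ)} {A B : Finset ℕ}
    (hA : A ∈ ascSet n d X (binom n (d + 1))) (hB : B ∈ ascSet n d X (binom n (d + 1)))
    (h : (A ∩ B).card = d) :
    ∃ S : Finset ℕ, ∃ a b, S.card = d ∧ a ∉ S ∧ b ∉ S ∧ a ≠ b ∧
      A = insert a S ∧ B = insert b S := by
  obtain ⟨a, ha, hAS⟩ :=
    exists_eq_insert_inter (mem_powersetCard.1 (mem_ascSet.1 hA).1.1).2 h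
  rw [inter_comm] at h
  obtain ⟨b, hb, hBS⟩ :=
    exists_eq_insert_inter (mem_powersetCard.1 (mem_ascSet.1 hB).1.1).2 h
  rw [inter_comm] at h hBS
  refine ⟨A ∩ B, a, b, h, by simp [ha], by simp [hb], ?_, hAS, hBS⟩
  rintro rfl
  exact ha (hBS ▸ mem_insert_self _ _)

theorem lexLT_insert_iff {S : Finset ℕ} {a b : ℕ} (ha : a ∉ S) (hb : b ∉ S) (hab : a ≠ b) :
    LexLT (insert a S) (insert b S) ↔ a < b := by
  constructor
  · rintro ⟨m, hm, hm', h⟩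
    simp only [mem_insert] at hm hm' h
    by_contra hlt
    have := h b
    grind
  · intro h
    refine ⟨a, by simp, by simp [ha, hab], fun x hx => ?_⟩
    simp only [mem_insert]
    grind

/-- Two ascents sharing a `d`-set `S` whose remaining elements lie on the same side
of `S` coincide. -/
theorem eq_of_same_side {n d : ℕ} (hd : 1 ≤ d) {X : Finset (Finset ℕ)} {S : Finset ℕ}
    (hS : S.card = d) {x y : ℕ} (hx : x ∉ S) (hy : y ∉ S)
    (hA : insert x S ∈ ascSet n d X (binom n (d + 1)))
    (hB : insert y S ∈ ascSet n d X (binom n (d + 1)))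
    (h : (∀ c ∈ S, x < c ∧ y < c) ∨ ∀ c ∈ S, c < x ∧ c < y) : x = y := by
  obtain ⟨c, hc⟩ : S.Nonempty := card_pos.1 (by omega)
  rcases lt_trichotomy x y with hxy | hxy | hxy
  · have := between_of_mem_ascSet hd hS hx hy hxy hA hB hc
    rcases h with h | h <;> have := h c hc <;> omega
  · exact hxy
  · have := between_of_mem_ascSet hd hS hy hx hxy hB hA hc
    rcases h with h | h <;> have := h c hc <;> omega

theorem eq_of_lexLT_right {n d : ℕ} (hd : 1 ≤ d) {X : Finset (Finset ℕ)} {I J₁ J₂ : Finset ℕ}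
    (hI : I ∈ ascSet n d X (binom n (d + 1))) (h₁ : J₁ ∈ ascSet n d X (binom n (d + 1)))
    (h₂ : J₂ ∈ ascSet n d X (binom n (d + 1))) (c₁ : (I ∩ J₁).card = d)
    (c₂ : (I ∩ J₂).card = d) (l₁ : LexLT I J₁) (l₂ : LexLT I J₂) : J₁ = J₂ := by
  obtain ⟨S, a, x, hS, ha, hx, hax, hIS, rfl⟩ := exists_exchange hI h₁ c₁
  obtain ⟨T, b, y, hT, hb, hy, hby, hIT, rfl⟩ := exists_exchange hI h₂ c₂
  rw [hIS, lexLT_insert_iff ha hx hax] at l₁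
  rw [hIT, lexLT_insert_iff hb hy hby] at l₂
  have k₁ := fun c => between_of_mem_ascSet (c := c) hd hS ha hx l₁ (hIS ▸ hI) h₁
  have k₂ := fun c => between_of_mem_ascSet (c := c) hd hT hb hy l₂ (hIT ▸ hI) h₂
  have hab : a = b := by
    have m₁ : a ∈ insert b T := hIT ▸ hIS ▸ mem_insert_self a S
    have m₂ : b ∈ insert a S := hIS ▸ hIT ▸ mem_insert_self b T
    grind
  subst hab
  have hST : S = T := by rw [← erase_insert ha, ← hIS, hIT, erase_insert hb]
  subst hST
  rw [eq_of_same_side hd hS hx hy h₁ h₂ (.inr fun c hc => ⟨(k₁ c hc).2, (k₂ c hc).2⟩)]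

theorem eq_of_lexLT_left {n d : ℕ} (hd : 1 ≤ d) {X : Finset (Finset ℕ)} {I L₁ L₂ : Finset ℕ}
    (hI : I ∈ ascSet n d X (binom n (d + 1))) (h₁ : L₁ ∈ ascSet n d X (binom n (d + 1)))
    (h₂ : L₂ ∈ ascSet n d X (binom n (d + 1))) (c₁ : (I ∩ L₁).card = d)
    (c₂ : (I ∩ L₂).card = d) (l₁ : LexLT L₁ I) (l₂ : LexLT L₂ I) : L₁ = L₂ := by
  obtain ⟨S, a, x, hS, ha, hx, hax, hIS, rfl⟩ := exists_exchange hI h₁ c₁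
  obtain ⟨T, b, y, hT, hb, hy, hby, hIT, rfl⟩ := exists_exchange hI h₂ c₂
  rw [hIS, lexLT_insert_iff hx ha hax.symm] at l₁
  rw [hIT, lexLT_insert_iff hy hb hby.symm] at l₂
  have k₁ := fun c => between_of_mem_ascSet (c := c) hd hS hx ha l₁ h₁ (hIS ▸ hI)
  have k₂ := fun c => between_of_mem_ascSet (c := c) hd hT hy hb l₂ h₂ (hIT ▸ hI)
  have hab : a = b := by
    have m₁ : a ∈ insert b T := hIT ▸ hIS ▸ mem_insert_self a S
    have m₂ : b ∈ insert a S := hIS ▸ hIT ▸ mem_insert_self b T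
    grind
  subst hab
  have hST : S = T := by rw [← erase_insert ha, ← hIS, hIT, erase_insert hb]
  subst hST
  rw [eq_of_same_side hd hS hx hy h₁ h₂ (.inl fun c hc => ⟨(k₁ c hc).1, (k₂ c hc).1⟩)]

theorem lexLT_or_lexLT {n d : ℕ} {X : Finset (Finset ℕ)} {A B : Finset ℕ}
    (hA : A ∈ ascSet n d X (binom n (d + 1))) (hB : B ∈ ascSet n d X (binom n (d + 1)))
    (h : (A ∩ B).card = d) : LexLT A B ∨ LexLT B A := by
  obtain ⟨S, a, b, -, ha, hb, hab, rfl, rfl⟩ := exists_exchange hA hB h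
  rw [lexLT_insert_iff ha hb hab, lexLT_insert_iff hb ha hab.symm]
  omega

/-- Each ascent `I` of a consistent set has at most one lexicographically larger and
at most one lexicographically smaller ascent sharing `d` elements with it; in
particular at most two ascents other than `I` share `d` elements with `I`. -/
theorem ascent_neighbors (n d : ℕ) (hd : 1 ≤ d) (X : Finset (Finset ℕ))
    (hX : Consistent n d X) (I : Finset ℕ)
    (hI : I ∈ ascSet n d X (binom n (d + 1))) :
    (∀ J₁ ∈ ascSet n d X (binom n (d + 1)), ∀ J₂ ∈ ascSet n d X (binom n (d + 1)),
      (I ∩ J₁).card = d → (I ∩ J₂).card = d → LexLT I J₁ → LexLT I J₂ → J₁ = J₂) ∧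
    (∀ L₁ ∈ ascSet n d X (binom n (d + 1)), ∀ L₂ ∈ ascSet n d X (binom n (d + 1)),
      (I ∩ L₁).card = d → (I ∩ L₂).card = d → LexLT L₁ I → LexLT L₂ I → L₁ = L₂) ∧
    (∀ J₁ ∈ ascSet n d X (binom n (d + 1)), ∀ J₂ ∈ ascSet n d X (binom n (d + 1)),
      ∀ J₃ ∈ ascSet n d X (binom n (d + 1)),
      J₁ ≠ I → J₂ ≠ I → J₃ ≠ I →
      (I ∩ J₁).card = d → (I ∩ J₂).card = d → (I ∩ J₃).card = d →
      J₁ = J₂ ∨ J₁ = J₃ ∨ J₂ = J₃) := by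
  refine ⟨fun J₁ h₁ J₂ h₂ => eq_of_lexLT_right hd hI h₁ h₂,
    fun L₁ h₁ L₂ h₂ => eq_of_lexLT_left hd hI h₁ h₂,
    fun J₁ h₁ J₂ h₂ J₃ h₃ _ _ _ c₁ c₂ c₃ => ?_⟩
  have R := fun {J K} => eq_of_lexLT_right (J₁ := J) (J₂ := K) hd hI
  have L := fun {J K} => eq_of_lexLT_left (L₁ := J) (L₂ := K) hd hI
  rcases lexLT_or_lexLT hI h₁ c₁ with l₁ | l₁ <;>
    rcases lexLT_or_lexLT hI h₂ c₂ with l₂ | l₂ <;>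
    rcases lexLT_or_lexLT hI h₃ c₃ with l₃ | l₃
  · exact .inl (R h₁ h₂ c₁ c₂ l₁ l₂)
  · exact .inl (R h₁ h₂ c₁ c₂ l₁ l₂)
  · exact .inr (.inl (R h₁ h₃ c₁ c₃ l₁ l₃))
  · exact .inr (.inr (L h₂ h₃ c₂ c₃ l₂ l₃))
  · exact .inr (.inr (R h₂ h₃ c₂ c₃ l₂ l₃))
  · exact .inr (.inl (L h₁ h₃ c₁ c₃ l₁ l₃))
  · exact .inl (L h₁ h₂ c₁ c₂ l₁ l₂)
  · exact .inl (L h₁ h₂ c₁ c₂ l₁ l₂)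
end

section
/- Let n, d ∈ ℕ with d ≥ 1 and let X be a consistent subset of binom([n], d+1). Then the ascent set Asc(X) decomposes as a disjoint union Asc(X) = A_1 ⊔ ⋯ ⊔ A_N where: (1) for each t there exist r_t ≥ 1 and elements a_{t,1} < a_{t,2} < ⋯ < a_{t,r_t+d} of [n] such that A_t = { {a_{t,j}, a_{t,j+1}, …, a_{t,j+d}} : 1 ≤ j ≤ r_t } (i.e., A_t is the set of contiguous (d+1)-element windows in {a_{t,1}, …, a_{t,r_t+d}}); and (2) if I ∈ A_s and J ∈ A_t with s ≠ t, then |I ∩ J| < d. -/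
open Finset

/-- `J` arises from `I` by trading an element below all others for one above all others. -/
def ShiftsTo (I J : Finset ℕ) : Prop :=
  ∃ (C : Finset ℕ) (x y : ℕ), (∀ c ∈ C, x < c) ∧ (∀ c ∈ C, c < y) ∧
    I = insert x C ∧ J = insert y C

/-- Any two members of `S` sharing `d` elements are consecutive windows of their union. -/
def IsShiftFamily (d : ℕ) (S : Finset (Finset ℕ)) : Prop :=
  (∀ I ∈ S, I.card = d + 1) ∧
    ∀ I ∈ S, ∀ J ∈ S, I ≠ J → d ≤ (I ∩ J).card → ShiftsTo I J ∨ ShiftsTo J I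

/-- The length-`(d+1)` windows of the sequence `a 1, …, a (r + d)`. -/
def windows (d r : ℕ) (a : ℕ → ℕ) : Finset (Finset ℕ) :=
  (Finset.Icc 1 r).image (fun j => (Finset.Icc j (j + d)).image a)

/-- `A` is the set of length-`(d+1)` windows of a finite increasing sequence. -/
def IsBlock (d : ℕ) (A : Finset (Finset ℕ)) : Prop :=
  ∃ (r : ℕ) (a : ℕ → ℕ), 1 ≤ r ∧ (∀ i, 1 ≤ i → i < r + d → a i < a (i + 1)) ∧
    A = windows d r a

theorem mem_windows {d r : ℕ} {a : ℕ → ℕ} {I : Finset ℕ} :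
    I ∈ windows d r a ↔ ∃ j, 1 ≤ j ∧ j ≤ r ∧ (Finset.Icc j (j + d)).image a = I := by
  simp [windows, and_assoc]

theorem insert_lower_inj {C D : Finset ℕ} {x y : ℕ} (hx : ∀ c ∈ C, x < c)
    (hy : ∀ c ∈ D, y < c) (h : insert x C = insert y D) : x = y ∧ C = D := by
  have hxC : x ∉ C := fun h => lt_irrefl _ (hx x h)
  have hyD : y ∉ D := fun h => lt_irrefl _ (hy y h)
  have h1 : x ∈ insert y D := h ▸ mem_insert_self x C
  have h2 : y ∈ insert x C := h ▸ mem_insert_self y D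
  have hxy : x = y := by
    rcases mem_insert.1 h1 with h1 | h1
    · exact h1
    · rcases mem_insert.1 h2 with h2 | h2
      · exact h2.symm
      · exact absurd (hx y h2) (hy x h1).asymm
  subst hxy
  exact ⟨rfl, by rw [← erase_insert hxC, h, erase_insert hyD]⟩

theorem insert_upper_inj {C D : Finset ℕ} {x y : ℕ} (hx : ∀ c ∈ C, c < x)
    (hy : ∀ c ∈ D, c < y) (h : insert x C = insert y D) : x = y ∧ C = D := by
  have hxC : x ∉ C := fun h => lt_irrefl _ (hx x h)
  have hyD : y ∉ D := fun h => lt_irrefl _ (hy y h)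
  have h1 : x ∈ insert y D := h ▸ mem_insert_self x C
  have h2 : y ∈ insert x C := h ▸ mem_insert_self y D
  have hxy : x = y := by
    rcases mem_insert.1 h1 with h1 | h1
    · exact h1
    · rcases mem_insert.1 h2 with h2 | h2
      · exact h2.symm
      · exact absurd (hx y h2) (hy x h1).asymm
  subst hxy
  exact ⟨rfl, by rw [← erase_insert hxC, h, erase_insert hyD]⟩

theorem ShiftsTo.sup_lt {d : ℕ} (hd : 1 ≤ d) {I J : Finset ℕ} (hI : I.card = d + 1)
    (h : ShiftsTo I J) : I.sup id < J.sup id := by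
  obtain ⟨C, x, y, hx, hy, rfl, rfl⟩ := h
  have hC : C.Nonempty := by
    have := card_insert_le x C
    exact card_pos.1 (by omega)
  obtain ⟨c, hc⟩ := hC
  have hxc := hx c hc
  have hcy := hy c hc
  refine lt_of_lt_of_le ?_ (le_sup (f := id) (mem_insert_self y C))
  rw [Finset.sup_lt_iff (by simp only [id, bot_eq_zero]; omega)]
  intro b hb
  rcases mem_insert.1 hb with rfl | hb
  · exact hxc.trans hcy
  · exact hy b hb

/-- An element of a shift family has at most one predecessor. -/
theorem IsShiftFamily.left_unique {d : ℕ} (hd : 1 ≤ d) {S : Finset (Finset ℕ)}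
    (hS : IsShiftFamily d S) {I J J' : Finset ℕ} (hJ : J ∈ S) (hJ' : J' ∈ S)
    (h : ShiftsTo J I) (h' : ShiftsTo J' I) : J = J' := by
  by_contra hne
  have hcJ := hS.1 J hJ
  have hcJ' := hS.1 J' hJ'
  obtain ⟨C, x, y, hx, hy, rfl, rfl⟩ := h
  obtain ⟨C', x', y', hx', hy', rfl, hI⟩ := h'
  obtain ⟨rfl, rfl⟩ := insert_upper_inj hy hy' hI
  have hCx := card_insert_le x C
  have hC : C.Nonempty := card_pos.1 (by omega)
  have hle : d ≤ (insert x C ∩ insert x' C).card := by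
    have : C ⊆ insert x C ∩ insert x' C :=
      subset_inter (subset_insert _ _) (subset_insert _ _)
    have := card_le_card this
    omega
  have key : ∀ u v : ℕ, (∀ c ∈ C, u < c) → (∀ c ∈ C, v < c) → u ≠ v →
      ¬ ShiftsTo (insert u C) (insert v C) := by
    rintro u v hu hv huv ⟨D, p, q, hp, hq, h1, h2⟩
    obtain ⟨rfl, rfl⟩ := insert_lower_inj hu hp h1
    obtain ⟨c, hc⟩ := hC
    have hvC : v ∈ insert q C := h2 ▸ mem_insert_self v C
    rcases mem_insert.1 hvC with rfl | hvC
    · exact (hv c hc).asymm (hq c hc)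
    · exact lt_irrefl _ (hv v hvC)
  have hxx : x ≠ x' := by
    rintro rfl
    exact hne rfl
  rcases hS.2 _ hJ _ hJ' hne hle with h | h
  · exact key x x' hx hx' hxx h
  · exact key x' x hx' hx hxx.symm h

theorem isBlock_singleton {d : ℕ} {I : Finset ℕ} (hI : I.card = d + 1) : IsBlock d {I} := by
  have hfin : (Set.ofPred (· ∈ I)).Finite := I.finite_toSet
  have hcard : hfin.toFinset.card = d + 1 := by
    rw [← hI]
    congr 1
    ext
    rw [Set.Finite.mem_toFinset]
    rfl
  refine ⟨1, fun i => Nat.nth (· ∈ I) (i - 1), le_rfl, ?_, ?_⟩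
  · intro i hi hid
    exact Nat.nth_lt_nth_of_lt_card hfin (by omega) (by omega)
  · have himg : (Finset.Icc 1 (1 + d)).image (fun i => Nat.nth (· ∈ I) (i - 1)) = I := by
      ext m
      simp only [mem_image, Finset.mem_Icc]
      constructor
      · rintro ⟨i, hi, rfl⟩
        exact Nat.nth_mem_of_lt_card hfin (by omega)
      · intro hm
        obtain ⟨k, hk, rfl⟩ := Nat.exists_lt_card_finite_nth_eq hfin hm
        exact ⟨k + 1, by omega, by simp⟩
    simp [windows, himg]

theorem lt_of_step_lt {m : ℕ} {a : ℕ → ℕ} (ha : ∀ i, 1 ≤ i → i < m → a i < a (i + 1))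
    (i j : ℕ) (hi : 1 ≤ i) (hij : i < j) : j ≤ m → a i < a j := by
  induction j, hij using Nat.le_induction with
  | base => exact fun hj => ha i hi hj
  | succ k hk ih => exact fun hj => (ih (by omega)).trans (ha k (by omega) (by omega))

/-- A shift of the last window of a block extends the block. -/
theorem isBlock_insert {d r : ℕ} (hd : 1 ≤ d) {a : ℕ → ℕ} {I : Finset ℕ}
    (ha : ∀ i, 1 ≤ i → i < r + d → a i < a (i + 1)) (hr : 1 ≤ r)
    (h : ShiftsTo ((Finset.Icc r (r + d)).image a) I) : IsBlock d (insert I (windows d r a)) := by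
  obtain ⟨C, x, y, hx, hy, hJ, rfl⟩ := h
  have hmono := lt_of_step_lt ha
  have hsplit : (Finset.Icc r (r + d)).image a =
      insert (a r) ((Finset.Icc (r + 1) (r + d)).image a) := by
    rw [← image_insert]
    congr 1
    ext
    simp only [mem_insert, Finset.mem_Icc]
    omega
  have hlow : ∀ c ∈ (Finset.Icc (r + 1) (r + d)).image a, a r < c := by
    intro c hc
    obtain ⟨i, hi, rfl⟩ := mem_image.1 hc
    rw [Finset.mem_Icc] at hi
    exact hmono r i hr (by omega) hi.2
  obtain ⟨rfl, rfl⟩ := insert_lower_inj hx hlow (hJ.symm.trans hsplit)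
  have hlast : a (r + d) < y := hy _ (mem_image_of_mem _ (by rw [Finset.mem_Icc]; omega))
  set b : ℕ → ℕ := fun i => if i ≤ r + d then a i else y with hb
  have hba : ∀ i j, j ≤ r + d → (Finset.Icc i j).image b = (Finset.Icc i j).image a := by
    intro i j hj
    refine image_congr fun k hk => ?_
    have hk : k ≤ r + d := (Finset.mem_Icc.1 hk).2.trans hj
    simp [hb, hk]
  have hnew : (Finset.Icc (r + 1) (r + 1 + d)).image b =
      insert y ((Finset.Icc (r + 1) (r + d)).image a) := by
    have hIcc : Finset.Icc (r + 1) (r + 1 + d) =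
        insert (r + d + 1) (Finset.Icc (r + 1) (r + d)) := by
      ext
      simp only [mem_insert, Finset.mem_Icc]
      omega
    rw [hIcc, image_insert, hba _ _ le_rfl]
    simp [hb]
  refine ⟨r + 1, b, by omega, ?_, ?_⟩
  · intro i hi hir
    rcases (by omega : i < r + d ∨ i = r + d) with h | rfl
    · simpa [hb, h.le, Nat.succ_le_of_lt h] using ha i hi h
    · simpa [hb] using hlast
  · ext L
    rw [mem_insert, mem_windows, mem_windows]
    constructor
    · rintro (rfl | ⟨j, hj, hjr, rfl⟩)
      · exact ⟨r + 1, by omega, le_rfl, hnew⟩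
      · exact ⟨j, hj, by omega, hba _ _ (by omega)⟩
    · rintro ⟨j, hj, hjr, rfl⟩
      rcases (by omega : j = r + 1 ∨ j ≤ r) with rfl | hjr
      · exact Or.inl hnew
      · exact Or.inr ⟨j, hj, hjr, (hba _ _ (by omega)).symm⟩

/-- Consecutive windows of an increasing sequence shift to one another. -/
theorem shiftsTo_succ_window {d r j : ℕ} {a : ℕ → ℕ}
    (ha : ∀ i, 1 ≤ i → i < r + d → a i < a (i + 1)) (hj : 1 ≤ j) (hjr : j < r) :
    ShiftsTo ((Finset.Icc j (j + d)).image a) ((Finset.Icc (j + 1) (j + 1 + d)).image a) := by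
  have hmono := lt_of_step_lt ha
  refine ⟨(Finset.Icc (j + 1) (j + d)).image a, a j, a (j + 1 + d), ?_, ?_, ?_, ?_⟩
  · intro c hc
    obtain ⟨i, hi, rfl⟩ := mem_image.1 hc
    rw [Finset.mem_Icc] at hi
    exact hmono j i hj (by omega) (by omega)
  · intro c hc
    obtain ⟨i, hi, rfl⟩ := mem_image.1 hc
    rw [Finset.mem_Icc] at hi
    exact hmono i _ (by omega) (by omega) (by omega)
  · rw [← image_insert]
    congr 1
    ext
    simp only [mem_insert, Finset.mem_Icc]
    omega
  · rw [← image_insert]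
    congr 1
    ext
    simp only [mem_insert, Finset.mem_Icc]
    omega

/-- A shift family is partitioned into mutually separated blocks. -/
theorem IsShiftFamily.exists_blocks {d : ℕ} (hd : 1 ≤ d) (S : Finset (Finset ℕ)) :
    IsShiftFamily d S → ∃ 𝒜 : Finset (Finset (Finset ℕ)), S = 𝒜.biUnion id ∧
      (∀ A ∈ 𝒜, IsBlock d A) ∧
      ∀ A ∈ 𝒜, ∀ B ∈ 𝒜, A ≠ B → ∀ I ∈ A, ∀ J ∈ B, (I ∩ J).card < d := by
  induction S using Finset.induction_on_max_value (fun I : Finset ℕ => I.sup id) with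
  | empty => exact fun _ => ⟨∅, by simp⟩
  | insert I S hIS hmax ih =>
    intro hS
    have hS' : IsShiftFamily d S :=
      ⟨fun J hJ => hS.1 J (mem_insert_of_mem hJ), fun J hJ K hK =>
        hS.2 J (mem_insert_of_mem hJ) K (mem_insert_of_mem hK)⟩
    have hI := hS.1 I (mem_insert_self I S)
    have hshift : ∀ J ∈ S, d ≤ (I ∩ J).card → ShiftsTo J I := by
      intro J hJ hle
      have hne : I ≠ J := by
        rintro rfl
        exact hIS hJ
      rcases hS.2 I (mem_insert_self I S) J (mem_insert_of_mem hJ) hne hle with h | h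
      · exact absurd (h.sup_lt hd hI) (hmax J hJ).not_gt
      · exact h
    obtain ⟨𝒜, hU, hB, hsep⟩ := ih hS'
    have hmem : ∀ {A J}, A ∈ 𝒜 → J ∈ A → J ∈ S := by
      intro A J hA hJ
      rw [hU]
      exact mem_biUnion.2 ⟨A, hA, hJ⟩
    by_cases hJ : ∃ J ∈ S, d ≤ (I ∩ J).card
    · obtain ⟨J, hJ, hle⟩ := hJ
      have hJI := hshift J hJ hle
      have huniq : ∀ K ∈ S, d ≤ (I ∩ K).card → K = J := fun K hK hle =>
        hS'.left_unique hd hK hJ (hshift K hK hle) hJI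
      obtain ⟨A, hA, hJA⟩ := mem_biUnion.1 (hU ▸ hJ)
      simp only [id] at hJA
      have hIB : ∀ B ∈ 𝒜, B ≠ A → ∀ K ∈ B, (I ∩ K).card < d := by
        intro B hB hBA K hK
        by_contra! hle
        obtain rfl := huniq K (hmem hB hK) hle
        have h1 := hsep B hB A hA hBA K hK K hJA
        rw [inter_self, hS'.1 K hJ] at h1
        omega
      obtain ⟨r, a, hr, ha, hAw⟩ := hB A hA
      have hblock : IsBlock d (insert I A) := by
        subst hAw
        obtain ⟨j, hj, hjr, rfl⟩ := mem_windows.1 hJA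
        rcases hjr.eq_or_lt with rfl | hjr
        · exact isBlock_insert hd ha hr hJI
        · exfalso
          have hnext := shiftsTo_succ_window ha hj hjr
          have hKS := hmem hA (mem_windows.2 ⟨j + 1, by omega, by omega, rfl⟩)
          have hsup := hnext.sup_lt hd (hS'.1 _ hJ)
          have hle' : d ≤ (I ∩ (Finset.Icc (j + 1) (j + 1 + d)).image a).card := by
            obtain ⟨C, x, y, hx, hy, h1, h2⟩ := hnext
            obtain ⟨D, p, q, hp, hq, h3, h4⟩ := hJI
            obtain ⟨-, rfl⟩ := insert_lower_inj hx hp (h1.symm.trans h3)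
            have hc := hS'.1 _ hJ
            rw [h1] at hc
            have hcC := card_insert_le x C
            have hsub : C ⊆ I ∩ (Finset.Icc (j + 1) (j + 1 + d)).image a := by
              rw [h2, h4]
              exact subset_inter (subset_insert _ _) (subset_insert _ _)
            have := card_le_card hsub
            omega
          rw [huniq _ hKS hle'] at hsup
          exact lt_irrefl _ hsup
      refine ⟨insert (insert I A) (𝒜.erase A), ?_, ?_, ?_⟩
      · rw [biUnion_insert, id, insert_union, hU]
        conv_lhs => rw [← insert_erase hA, biUnion_insert, id]
      · intro B hB'
        rcases mem_insert.1 hB' with rfl | hB'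
        · exact hblock
        · exact hB B (mem_of_mem_erase hB')
      · have hIA : ∀ B ∈ 𝒜.erase A, ∀ K ∈ insert I A, ∀ L ∈ B, (K ∩ L).card < d := by
          intro B hB K hK L hL
          obtain ⟨hBA, hB⟩ := mem_erase.1 hB
          rcases mem_insert.1 hK with rfl | hK
          · exact hIB B hB hBA L hL
          · exact hsep A hA B hB hBA.symm K hK L hL
        intro B hB C hC hBC K hK L hL
        rcases mem_insert.1 hB with rfl | hB <;> rcases mem_insert.1 hC with rfl | hC
        · exact absurd rfl hBC
        · exact hIA C hC K hK L hL
        · rw [inter_comm]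
          exact hIA B hB L hL K hK
        · exact hsep B (mem_of_mem_erase hB) C (mem_of_mem_erase hC) hBC K hK L hL
    · push Not at hJ
      refine ⟨insert {I} 𝒜, ?_, ?_, ?_⟩
      · rw [biUnion_insert, id, ← hU]
        rfl
      · intro B hB'
        rcases mem_insert.1 hB' with rfl | hB'
        · exact isBlock_singleton hI
        · exact hB B hB'
      · intro B hB C hC hBC K hK L hL
        rcases mem_insert.1 hB with rfl | hB <;> rcases mem_insert.1 hC with rfl | hC
        · exact absurd rfl hBC
        · rw [mem_singleton.1 hK]
          exact hJ L (hmem hC hL)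
        · rw [mem_singleton.1 hL, inter_comm]
          exact hJ K (hmem hB hK)
        · exact hsep B hB C hC hBC K hK L hL

/-- Closedness forces `Q` to lie on the same side as `P` and `L` whenever these two agree. If this
holds both for `X ∪ {P}` and for the complement of `X ∪ {Q}`, then `P` and `Q` cannot both be
missing from `X`. -/
theorem not_ascents_of_closed {n d : ℕ} {X : Finset (Finset ℕ)} {P Q L : Finset ℕ}
    (hP : P ∈ binom n (d + 1)) (hL : L ∈ binom n (d + 1)) (hPX : P ∉ X) (hQX : Q ∉ X)
    (hPQ : P ≠ Q) (hLQ : L ≠ Q)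
    (h₁ : P ∈ X ∪ {P} → L ∈ X ∪ {P} → Q ∈ X ∪ {P})
    (h₂ : P ∈ binom n (d + 1) \ (X ∪ {Q}) → L ∈ binom n (d + 1) \ (X ∪ {Q}) →
      Q ∈ binom n (d + 1) \ (X ∪ {Q})) : False := by
  simp only [mem_union, mem_sdiff, mem_singleton] at h₁ h₂
  have := hPQ.symm
  tauto

/-- Ascents sharing `d` elements are the two end members of their packet. -/
theorem isShiftFamily_ascSet {n d : ℕ} (hd : 1 ≤ d) (X : Finset (Finset ℕ)) :
    IsShiftFamily d (ascSet n d X (binom n (d + 1))) := by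
  have hcard : ∀ I ∈ ascSet n d X (binom n (d + 1)), I ⊆ box n ∧ I.card = d + 1 :=
    fun I hI => mem_powersetCard.1 (mem_ascSet.1 hI).1.1
  have main : ∀ (C : Finset ℕ) (u v : ℕ), u ∉ C → v ∉ C → u < v →
      insert u C ∈ ascSet n d X (binom n (d + 1)) →
      insert v C ∈ ascSet n d X (binom n (d + 1)) → ShiftsTo (insert u C) (insert v C) := by
    intro C u v hu hv huv hI hJ
    have hIc := hcard _ hI
    have hJc := hcard _ hJ
    obtain ⟨⟨hIb, hIX⟩, -, hIcl, hIco⟩ := mem_ascSet.1 hI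
    obtain ⟨⟨hJb, hJX⟩, -, hJcl, hJco⟩ := mem_ascSet.1 hJ
    have hun := hIc.1 (mem_insert_self u C)
    have hvn := hJc.1 (mem_insert_self v C)
    have hCn : C ⊆ box n := (subset_insert _ _).trans hIc.1
    have hCd : C.card = d := by simpa [hu] using hIc.2
    have key : ∀ c ∈ C, C.erase c ∈ binom n (d - 1) ∧ c ∉ C.erase c ∧ u ∉ C.erase c ∧
        v ∉ C.erase c ∧ C.erase c ∪ {u, v} ∈ binom n (d + 1) ∧
        C.erase c ∪ {c, u} = insert u C ∧ C.erase c ∪ {c, v} = insert v C ∧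
        C.erase c ∪ {u, v} ≠ insert u C ∧ C.erase c ∪ {u, v} ≠ insert v C := by
      intro c hc
      have hcu : c ≠ u := by
        rintro rfl
        exact hu hc
      have hcv : c ≠ v := by
        rintro rfl
        exact hv hc
      have heq : ∀ w, C.erase c ∪ {c, w} = insert w C := by
        intro w
        ext z
        simp only [mem_union, mem_erase, mem_insert, mem_singleton]
        by_cases hz : z = c
        · simp [hz, hc]
        · simp [hz, or_comm]
      have hcL : c ∉ C.erase c ∪ {u, v} := by simp [hcu, hcv]
      have hne : ∀ w, C.erase c ∪ {u, v} ≠ insert w C := by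
        intro w h
        exact hcL (h ▸ mem_insert_of_mem hc)
      have hue : u ∉ C.erase c := fun h => hu (mem_of_mem_erase h)
      have hve : v ∉ C.erase c := fun h => hv (mem_of_mem_erase h)
      refine ⟨mem_powersetCard.2 ⟨(erase_subset _ _).trans hCn, ?_⟩, notMem_erase _ _, hue, hve,
        mem_powersetCard.2 ⟨?_, ?_⟩, heq u, heq v, hne u, hne v⟩
      · rw [card_erase_of_mem hc, hCd]
      · refine union_subset ((erase_subset _ _).trans hCn) ?_
        simp [insert_subset_iff, hun, hvn]
      · rw [card_union_of_disjoint (by simp [hue, hve]), card_erase_of_mem hc, hCd,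
          card_pair huv.ne]
        omega
    have hne : insert u C ≠ insert v C := by
      intro h
      have : u ∈ insert v C := h ▸ mem_insert_self u C
      simp [huv.ne, hu] at this
    refine ⟨C, u, v, fun c hc => ?_, fun c hc => ?_, rfl, rfl⟩
    · obtain ⟨hD, hcD, huD, hvD, hL, e₁, e₂, -, hLv⟩ := key c hc
      by_contra! hcu
      have hcu : c < u := lt_of_le_of_ne hcu (by rintro rfl; exact hu hc)
      have h₁ := hIcl _ hD c (hCn hc) u hun v hvn hcD huD hvD hcu huv
      have h₂ := hJco _ hD c (hCn hc) u hun v hvn hcD huD hvD hcu huv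
      rw [e₁, e₂] at h₁ h₂
      exact not_ascents_of_closed hIb hL hIX hJX hne hLv h₁ h₂
    · obtain ⟨hD, hcD, huD, hvD, hL, e₁, e₂, hLu, -⟩ := key c hc
      by_contra! hvc
      have hvc : v < c := lt_of_le_of_ne hvc (by rintro rfl; exact hv hc)
      have h₁ := hJcl _ hD u hun v hvn c (hCn hc) huD hvD hcD huv hvc
      have h₂ := hIco _ hD u hun v hvn c (hCn hc) huD hvD hcD huv hvc
      rw [pair_comm u c, pair_comm v c, e₁, e₂] at h₁ h₂
      exact not_ascents_of_closed hJb hL hJX hIX hne.symm hLu (fun a b => h₁ b a)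
        (fun a b => h₂ b a)
  refine ⟨fun I hI => (hcard I hI).2, fun I hI J hJ hne hle => ?_⟩
  have hIc := (hcard I hI).2
  have hJc := (hcard J hJ).2
  have hlt : (I ∩ J).card < d + 1 := by
    by_contra! h
    have h1 : I ∩ J = I := eq_of_subset_of_card_le inter_subset_left (by omega)
    have h2 : I ∩ J = J := eq_of_subset_of_card_le inter_subset_right (by omega)
    exact hne (h1.symm.trans h2)
  have hI1 := card_sdiff_add_card_inter I J
  have hJ1 := card_sdiff_add_card_inter J I
  rw [inter_comm] at hJ1
  obtain ⟨u, hu⟩ := card_eq_one.1 (by omega : (I \ J).card = 1)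
  obtain ⟨v, hv⟩ := card_eq_one.1 (by omega : (J \ I).card = 1)
  have hIe : insert u (I ∩ J) = I := by
    rw [insert_eq, ← hu, sdiff_union_inter]
  have hJe : insert v (I ∩ J) = J := by
    rw [insert_eq, ← hv, inter_comm, sdiff_union_inter]
  have huI : u ∈ I \ J := hu ▸ mem_singleton_self u
  have hvJ : v ∈ J \ I := hv ▸ mem_singleton_self v
  rw [mem_sdiff] at huI hvJ
  have huC : u ∉ I ∩ J := fun h => huI.2 (mem_inter.1 h).2
  have hvC : v ∉ I ∩ J := fun h => hvJ.2 (mem_inter.1 h).1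
  have huv : u ≠ v := by
    rintro rfl
    exact huI.2 hvJ.1
  rcases huv.lt_or_gt with h | h
  · have := main _ u v huC hvC h (by rwa [hIe]) (by rwa [hJe])
    rw [hIe, hJe] at this
    exact Or.inl this
  · have := main _ v u hvC huC h (by rwa [hJe]) (by rwa [hIe])
    rw [hIe, hJe] at this
    exact Or.inr this

/-- The ascent set of a consistent set decomposes into disjoint blocks of
contiguous `(d+1)`-element windows, members of different blocks sharing fewer than
`d` elements. -/
theorem ascent_decomposition (n d : ℕ) (hd : 1 ≤ d) (X : Finset (Finset ℕ))
    (hX : Consistent n d X) :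
    ∃ (N : ℕ) (A : Fin N → Finset (Finset ℕ)),
      ascSet n d X (binom n (d + 1)) = Finset.univ.biUnion (fun t => A t) ∧
      (∀ s t : Fin N, s ≠ t → Disjoint (A s) (A t)) ∧
      (∀ t : Fin N, ∃ (r : ℕ) (a : ℕ → ℕ), 1 ≤ r ∧
        (∀ i, 1 ≤ i → i ≤ r + d → a i ∈ box n) ∧
        (∀ i, 1 ≤ i → i < r + d → a i < a (i + 1)) ∧
        A t = (Finset.Icc 1 r).image (fun j => (Finset.Icc j (j + d)).image a)) ∧
      (∀ s t : Fin N, s ≠ t → ∀ I ∈ A s, ∀ J ∈ A t, (I ∩ J).card < d) := by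
  have hS := isShiftFamily_ascSet (n := n) hd X
  obtain ⟨𝒜, hU, hB, hsep⟩ := IsShiftFamily.exists_blocks hd _ hS
  have hmem : ∀ {A J}, A ∈ 𝒜 → J ∈ A → J ∈ ascSet n d X (binom n (d + 1)) := by
    intro A J hA hJ
    rw [hU]
    exact mem_biUnion.2 ⟨A, hA, hJ⟩
  have hsep' : ∀ s t : Fin 𝒜.card, s ≠ t → ∀ I ∈ (𝒜.equivFin.symm s : Finset (Finset ℕ)),
      ∀ J ∈ (𝒜.equivFin.symm t : Finset (Finset ℕ)), (I ∩ J).card < d := fun s t hst =>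
    hsep _ (𝒜.equivFin.symm s).2 _ (𝒜.equivFin.symm t).2
      fun h => hst (𝒜.equivFin.symm.injective (Subtype.ext h))
  refine ⟨𝒜.card, fun t => 𝒜.equivFin.symm t, ?_, ?_, ?_, hsep'⟩
  · rw [hU]
    ext I
    simp only [mem_biUnion, mem_univ, true_and, id]
    constructor
    · rintro ⟨A, hA, hI⟩
      exact ⟨𝒜.equivFin ⟨A, hA⟩, by simpa using hI⟩
    · rintro ⟨t, hI⟩
      exact ⟨_, (𝒜.equivFin.symm t).2, hI⟩
  · intro s t hst
    refine disjoint_left.2 fun I hIs hIt => ?_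
    have h := hsep' s t hst I hIs I hIt
    rw [inter_self, hS.1 I (hmem (𝒜.equivFin.symm s).2 hIs)] at h
    omega
  · intro t
    obtain ⟨r, a, hr, ha, hA⟩ := hB _ (𝒜.equivFin.symm t).2
    refine ⟨r, a, hr, fun i hi hir => ?_, ha, hA⟩
    have hW : (Finset.Icc (min i r) (min i r + d)).image a ∈
        (𝒜.equivFin.symm t : Finset (Finset ℕ)) := by
      rw [hA]
      exact mem_windows.2 ⟨min i r, by omega, by omega, rfl⟩
    have hbin := (mem_ascSet.1 (hmem (𝒜.equivFin.symm t).2 hW)).1.1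
    exact (mem_powersetCard.1 hbin).1
      (mem_image_of_mem a (by rw [Finset.mem_Icc]; omega))
end
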